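/- Let N be a compact topological n-manifold without boundary admitting a homotopy equivalence to the n-torus T^n = ℝ^n/ℤ^n, and let σ : N → N be an H_1-negative involution. Then the fixed-point set {x ∈ N | σ(x) = x} is finite and has exactly 2^n elements. -/

import Mathlib

/-- A (boundaryless) topological `n`-manifold structure: every point has an open
neighborhood homeomorphic to an open subset of `ℝⁿ`. -/
def LocallyEuclidean (n : ℕ) (N : Type) [TopologicalSpace N] : Prop :=
  ∀ x : N, ∃ (U : Set N) (V : Set (Fin n → ℝ)),
    IsOpen U ∧ x ∈ U ∧ IsOpen V ∧ Nonempty (U ≃ₜ V)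

/-- The `n`-torus `Tⁿ = ℝⁿ/ℤⁿ = (ℝ/ℤ)ⁿ`. -/
abbrev Torus (n : ℕ) := Fin n → AddCircle (1 : ℝ)

/-- An involution `σ` is `H₁`-negative if for every basepoint `x`, every loop
`γ` at `x` and every path `q` from `σ x` to `x`, the transport of `σ ∘ γ` back
to the basepoint `x` along `q` is (path-)homotopic to the reverse loop `γ⁻¹`;
i.e. `σ` induces `-1` on `π₁` (equivalently on `H₁`) at every basepoint. -/
def H1Negative {N : Type} [TopologicalSpace N] (σ : N → N) (hσ : Continuous σ) : Prop :=
  ∀ (x : N) (γ : Path x x) (q : Path (σ x) x),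
    (q.symm.trans ((γ.map hσ).trans q)).Homotopic γ.symm

namespace AlexanderSpanier

open Set Topology

variable {X Y Z : Type*}

/-- Alexander–Spanier cochains with coefficients in `𝔽₂`, all degrees at once; a `p`-cochain is
a function supported on lists of length `p + 1`. -/
abbrev Cochain (X : Type*) := List X → ZMod 2

/-- Auxiliary recursion for the coboundary. -/
def dAux : List X → Cochain X → ZMod 2
  | [], _ => 0
  | x :: l, φ => φ l + dAux l (fun m => φ (x :: m))

/-- The coboundary of a cochain. -/
def d (φ : Cochain X) : Cochain X := fun l => dAux l φ

@[simp] lemma d_nil (φ : Cochain X) : d φ [] = 0 := rfl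

lemma d_cons (φ : Cochain X) (x : X) (l : List X) :
    d φ (x :: l) = φ l + d (fun m => φ (x :: m)) l := rfl

lemma d_singleton (φ : Cochain X) (x : X) : d φ [x] = φ [] := by simp [d_cons]

lemma d_apply_add (φ ψ : Cochain X) (l : List X) : d (φ + ψ) l = d φ l + d ψ l := by
  induction l generalizing φ ψ with
  | nil => simp
  | cons x l ih =>
    have h : (fun m => (φ + ψ) (x :: m)) = (fun m => φ (x :: m)) + fun m => ψ (x :: m) := rfl
    rw [d_cons, d_cons, d_cons, h, ih]
    simp only [Pi.add_apply]
    ring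

lemma d_add (φ ψ : Cochain X) : d (φ + ψ) = d φ + d ψ := funext fun l => d_apply_add φ ψ l

@[simp] lemma d_zero : d (0 : Cochain X) = 0 := by
  have h := d_add (0 : Cochain X) 0
  simpa using h

lemma d_d (φ : Cochain X) : d (d φ) = 0 := by
  funext l
  induction l generalizing φ with
  | nil => rfl
  | cons x l ih =>
    have h : (fun m => d φ (x :: m)) = φ + d (fun m => φ (x :: m)) := rfl
    rw [d_cons, h, d_add, Pi.add_apply, ih]
    simp only [Pi.zero_apply]
    grind

lemma d_smul (c : ZMod 2) (φ : Cochain X) (l : List X) : d (fun m => c * φ m) l = c * d φ l := by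
  induction l generalizing φ with
  | nil => simp
  | cons x l ih => rw [d_cons, d_cons, ih]; ring

/-- If two cochains agree on lists with entries satisfying `p`, so do their coboundaries. -/
lemma d_congr {p : X → Prop} {φ ψ : Cochain X} (h : ∀ l, (∀ y ∈ l, p y) → φ l = ψ l)
    (l : List X) (hl : ∀ y ∈ l, p y) : d φ l = d ψ l := by
  induction l generalizing φ ψ with
  | nil => rfl
  | cons x l ih =>
    rw [List.forall_mem_cons] at hl
    rw [d_cons, d_cons, h l hl.2, ih (fun m hm => h _ (List.forall_mem_cons.2 ⟨hl.1, hm⟩)) hl.2]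

lemma d_eq_zero {p : X → Prop} {φ : Cochain X} (h : ∀ l, (∀ y ∈ l, p y) → φ l = 0)
    (l : List X) (hl : ∀ y ∈ l, p y) : d φ l = 0 := by
  rw [d_congr (ψ := 0) h l hl, d_zero, Pi.zero_apply]

/-- Pullback of cochains. -/
def pull (f : X → Y) (φ : Cochain Y) : Cochain X := fun l => φ (l.map f)

lemma pull_apply (f : X → Y) (φ : Cochain Y) (l : List X) : pull f φ l = φ (l.map f) := rfl

@[simp] lemma pull_nil (f : X → Y) (φ : Cochain Y) : pull f φ [] = φ [] := rfl

@[simp] lemma pull_add (f : X → Y) (φ ψ : Cochain Y) : pull f (φ + ψ) = pull f φ + pull f ψ := rfl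

@[simp] lemma pull_zero (f : X → Y) : pull f (0 : Cochain Y) = 0 := rfl

@[simp] lemma pull_id (φ : Cochain X) : pull id φ = φ := by
  funext l; simp [pull]

lemma pull_pull (f : X → Y) (g : Y → Z) (φ : Cochain Z) :
    pull f (pull g φ) = pull (g ∘ f) φ := by
  funext l; simp [pull]

lemma d_pull (f : X → Y) (φ : Cochain Y) : d (pull f φ) = pull f (d φ) := by
  funext l
  induction l generalizing φ with
  | nil => rfl
  | cons x l ih =>
    have h := ih (fun m => φ (f x :: m))
    rw [pull_apply, List.map_cons, d_cons, d_cons]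
    exact congrArg₂ _ rfl h

/-- The cochain is homogeneous, supported on nonempty lists of length `k`. -/
def Deg (k : ℕ) (φ : Cochain X) : Prop := φ [] = 0 ∧ ∀ l, l.length ≠ k → φ l = 0

lemma Deg.zero_eq {φ : Cochain X} (h : Deg 0 φ) : φ = 0 := by
  funext l
  cases l with
  | nil => exact h.1
  | cons x l => exact h.2 _ (by simp)

lemma deg_zero (k : ℕ) : Deg k (0 : Cochain X) := ⟨rfl, fun _ _ => rfl⟩

lemma Deg.add {k : ℕ} {φ ψ : Cochain X} (h : Deg k φ) (h' : Deg k ψ) : Deg k (φ + ψ) :=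
  ⟨by simp [h.1, h'.1], fun l hl => by simp [h.2 l hl, h'.2 l hl]⟩

lemma Deg.sum {ι : Type*} {s : Finset ι} {k : ℕ} {φ : ι → Cochain X}
    (h : ∀ i ∈ s, Deg k (φ i)) : Deg k (∑ i ∈ s, φ i) := by
  classical
  induction s using Finset.induction_on with
  | empty => exact deg_zero k
  | insert a s ha ih =>
    rw [Finset.sum_insert ha]
    exact (h a (by simp)).add (ih fun i hi => h i (by simp [hi]))

lemma Deg.pull {k : ℕ} {φ : Cochain Y} (h : Deg k φ) (f : X → Y) : Deg k (pull f φ) :=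
  ⟨h.1, fun l hl => h.2 _ (by simpa using hl)⟩

/-- The part of a cochain supported on lists of length `k`. -/
def comp (k : ℕ) (φ : Cochain X) : Cochain X := fun l => if l.length = k then φ l else 0

lemma d_comp (k : ℕ) (φ : Cochain X) : d (comp k φ) = comp (k + 1) (d φ) := by
  funext l
  induction l generalizing φ k with
  | nil => simp [comp]
  | cons x l ih =>
    rw [d_cons]
    cases k with
    | zero =>
      have h : (fun m => comp 0 φ (x :: m)) = 0 := by funext m; simp [comp]
      rw [h, d_zero]
      cases l <;> simp [comp, d_cons]
    | succ k =>
      have h : (fun m => comp (k + 1) φ (x :: m)) = comp k (fun m => φ (x :: m)) := by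
        funext m; simp [comp]
      rw [h, ih]
      simp only [comp, List.length_cons, d_cons, Nat.add_right_cancel_iff]
      split_ifs <;> simp

lemma deg_comp {k : ℕ} {φ : Cochain X} (h : φ [] = 0) : Deg k (comp k φ) :=
  ⟨by simp [comp, h], fun l hl => by simp [comp, hl]⟩

lemma comp_eq {k : ℕ} {φ : Cochain X} (h : Deg k φ) : comp k φ = φ := by
  funext l
  by_cases hl : l.length = k
  · simp [comp, hl]
  · simp [comp, hl, h.2 l hl]

lemma Deg.d {k : ℕ} {φ : Cochain X} (h : Deg k φ) : Deg (k + 1) (d φ) := by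
  rw [← comp_eq h, d_comp]
  exact deg_comp rfl

/-- Multiply a cochain by a function evaluated at the first entry. -/
def mulF (χ : X → ZMod 2) (φ : Cochain X) : Cochain X
  | [] => 0
  | x :: l => χ x * φ (x :: l)

@[simp] lemma mulF_nil (χ : X → ZMod 2) (φ : Cochain X) : mulF χ φ [] = 0 := rfl

lemma mulF_cons (χ : X → ZMod 2) (φ : Cochain X) (x : X) (l : List X) :
    mulF χ φ (x :: l) = χ x * φ (x :: l) := rfl

/-- The cup product with the coboundary of the function `χ`. -/
def cupd (χ : X → ZMod 2) (φ : Cochain X) : Cochain X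
  | [] => 0
  | x :: l => mulF χ φ l + χ x * φ l

@[simp] lemma cupd_nil (χ : X → ZMod 2) (φ : Cochain X) : cupd χ φ [] = 0 := rfl

lemma cupd_cons (χ : X → ZMod 2) (φ : Cochain X) (x : X) (l : List X) :
    cupd χ φ (x :: l) = mulF χ φ l + χ x * φ l := rfl

lemma d_mulF (χ : X → ZMod 2) (φ : Cochain X) : d (mulF χ φ) = cupd χ φ + mulF χ (d φ) := by
  funext l
  cases l with
  | nil => rfl
  | cons x l =>
    have h : (fun m => mulF χ φ (x :: m)) = fun m => χ x * φ (x :: m) := rfl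
    rw [d_cons, h, d_smul, Pi.add_apply, cupd_cons, mulF_cons, d_cons]
    grind

lemma mulF_add (χ : X → ZMod 2) (φ ψ : Cochain X) : mulF χ (φ + ψ) = mulF χ φ + mulF χ ψ := by
  funext l
  cases l with
  | nil => rfl
  | cons x l => simp [mulF_cons, mul_add]

lemma cupd_add (χ : X → ZMod 2) (φ ψ : Cochain X) : cupd χ (φ + ψ) = cupd χ φ + cupd χ ψ := by
  funext l
  cases l with
  | nil => rfl
  | cons x l => simp [cupd_cons, mulF_add]; ring

@[simp] lemma cupd_zero (χ : X → ZMod 2) : cupd χ 0 = 0 := by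
  have h := cupd_add χ 0 0
  simpa using h

lemma d_cupd (χ : X → ZMod 2) (φ : Cochain X) : d (cupd χ φ) = cupd χ (d φ) := by
  have h1 := congrArg d (d_mulF χ φ)
  rw [d_add, d_d, d_mulF, d_d] at h1
  have h2 : mulF χ (0 : Cochain X) = 0 := by
    have h := mulF_add χ (0 : Cochain X) 0
    simpa using h
  rw [h2] at h1
  grind

lemma pull_mulF (f : X → Y) (χ : Y → ZMod 2) (φ : Cochain Y) :
    pull f (mulF χ φ) = mulF (χ ∘ f) (pull f φ) := by
  funext l
  cases l <;> rfl

lemma pull_cupd (f : X → Y) (χ : Y → ZMod 2) (φ : Cochain Y) :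
    pull f (cupd χ φ) = cupd (χ ∘ f) (pull f φ) := by
  funext l
  cases l with
  | nil => rfl
  | cons x l =>
    rw [cupd_cons, ← pull_mulF]
    rfl

lemma Deg.mulF {k : ℕ} {φ : Cochain X} (h : Deg k φ) (χ : X → ZMod 2) : Deg k (mulF χ φ) := by
  refine ⟨rfl, fun l hl => ?_⟩
  cases l with
  | nil => rfl
  | cons x l => rw [mulF_cons, h.2 _ hl, mul_zero]

lemma Deg.cupd {k : ℕ} {φ : Cochain X} (h : Deg k φ) (χ : X → ZMod 2) :
    Deg (k + 1) (cupd χ φ) := by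
  refine ⟨rfl, fun l hl => ?_⟩
  cases l with
  | nil => rfl
  | cons x l =>
    have hl' : l.length ≠ k := by simpa using hl
    rw [cupd_cons, h.2 _ hl', (h.mulF χ).2 _ hl', mul_zero, add_zero]

/-- The unit cochain of degree zero. -/
def one : Cochain X := fun l => if l.length = 1 then 1 else 0

lemma deg_one : Deg 1 (one : Cochain X) := ⟨rfl, fun l hl => by simp [one, hl]⟩

lemma pull_one (f : X → Y) : pull f one = one := by
  funext l; simp [pull, one]

lemma d_one : d (one : Cochain X) = 0 := by
  funext l
  cases l with
  | nil => rfl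
  | cons x l =>
    have h : (fun m => (one : Cochain X) (x :: m)) = comp 0 (fun _ => 1) := by
      funext m; simp [one, comp]
    rw [d_cons, h, d_comp]
    cases l with
    | nil => simp [one, comp]
    | cons y l =>
      cases l with
      | nil => simp [one, comp, d_cons]; decide
      | cons z l => simp [one, comp]

/-- The cup product `δs₀ ∪ ⋯ ∪ δsₙ₋₁`. -/
def cupF : (n : ℕ) → (Fin n → X → ZMod 2) → Cochain X
  | 0, _ => one
  | n + 1, s => cupd (s 0) (cupF n (Fin.tail s))

lemma d_cupF (n : ℕ) (s : Fin n → X → ZMod 2) : d (cupF n s) = 0 := by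
  induction n with
  | zero => exact d_one
  | succ n ih => rw [cupF, d_cupd, ih, cupd_zero]

lemma deg_cupF (n : ℕ) (s : Fin n → X → ZMod 2) : Deg (n + 1) (cupF n s) := by
  induction n with
  | zero => exact deg_one
  | succ n ih => exact (ih _).cupd _

lemma pull_cupF (f : X → Y) (n : ℕ) (s : Fin n → Y → ZMod 2) :
    pull f (cupF n s) = cupF n (fun i => s i ∘ f) := by
  induction n with
  | zero => exact pull_one f
  | succ n ih => rw [cupF, pull_cupd, ih]; rfl

/-- The prism operator between the pullbacks by two maps. -/
def prism (f g : X → Y) : Cochain Y → Cochain X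
  | _, [] => 0
  | φ, x :: l => φ (f x :: g x :: l.map g) + prism f g (fun m => φ (f x :: m)) l

@[simp] lemma prism_nil (f g : X → Y) (φ : Cochain Y) : prism f g φ [] = 0 := by
  rw [prism]

lemma prism_cons (f g : X → Y) (φ : Cochain Y) (x : X) (l : List X) :
    prism f g φ (x :: l) =
      φ (f x :: g x :: l.map g) + prism f g (fun m => φ (f x :: m)) l := by
  rw [prism]

lemma prism_apply_add (f g : X → Y) (φ ψ : Cochain Y) (l : List X) :
    prism f g (φ + ψ) l = prism f g φ l + prism f g ψ l := by
  induction l generalizing φ ψ with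
  | nil => simp
  | cons x l ih =>
    have h : (fun m => (φ + ψ) (f x :: m)) =
      (fun m => φ (f x :: m)) + fun m => ψ (f x :: m) := rfl
    rw [prism_cons, prism_cons, prism_cons, h, ih]
    simp only [Pi.add_apply]
    ring

lemma prism_add (f g : X → Y) (φ ψ : Cochain Y) :
    prism f g (φ + ψ) = prism f g φ + prism f g ψ := funext fun l => prism_apply_add f g φ ψ l

lemma prism_eq_zero (f g : X → Y) {p : X → Prop} {φ : Cochain Y}
    (h : ∀ l, l ≠ [] → (∀ y ∈ l, ∃ x, p x ∧ (y = f x ∨ y = g x)) → φ l = 0)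
    (l : List X) (hl : ∀ x ∈ l, p x) : prism f g φ l = 0 := by
  induction l generalizing φ with
  | nil => simp
  | cons x l ih =>
    rw [List.forall_mem_cons] at hl
    rw [prism_cons, h _ (by simp), ih _ hl.2, add_zero]
    · intro m _ hm'
      exact h _ (by simp) (List.forall_mem_cons.2 ⟨⟨x, hl.1, Or.inl rfl⟩, hm'⟩)
    · refine List.forall_mem_cons.2 ⟨⟨x, hl.1, Or.inl rfl⟩,
        List.forall_mem_cons.2 ⟨⟨x, hl.1, Or.inr rfl⟩, ?_⟩⟩
      intro y hy
      obtain ⟨z, hz, rfl⟩ := List.mem_map.1 hy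
      exact ⟨z, hl.2 z hz, Or.inr rfl⟩

lemma d_prism (f g : X → Y) (φ : Cochain Y) :
    d (prism f g φ) + prism f g (d φ) = pull f φ + pull g φ := by
  funext l
  induction l generalizing φ with
  | nil => simp; grind
  | cons x l ih =>
    have h1 : (fun m => prism f g φ (x :: m)) =
        pull g (fun m => φ (f x :: g x :: m)) + prism f g (fun m => φ (f x :: m)) := by
      funext m; rw [prism_cons]; rfl
    have h2 : (fun m => d φ (f x :: m)) = φ + d (fun m => φ (f x :: m)) := rfl
    have h3 := ih (fun m => φ (f x :: m))
    simp only [Pi.add_apply, pull_apply] at h3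
    simp only [Pi.add_apply, pull_apply, List.map_cons]
    rw [d_cons, h1, d_add, prism_cons, h2, prism_add, d_cons, d_cons, d_pull]
    simp only [Pi.add_apply, pull_apply]
    grind

lemma prism_apply_eq_zero (f g : X → Y) {φ : Cochain Y} (l : List X)
    (h : ∀ m : List Y, m.length = l.length + 1 → φ m = 0) : prism f g φ l = 0 := by
  induction l generalizing φ with
  | nil => simp
  | cons x l ih =>
    rw [prism_cons, h _ (by simp), ih fun m hm => h _ (by simp [hm]), add_zero]

lemma Deg.prism {k : ℕ} {φ : Cochain Y} (h : Deg k φ) (f g : X → Y) :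
    Deg (k - 1) (prism f g φ) := by
  refine ⟨prism_nil _ _ _, fun l hl => prism_apply_eq_zero f g l fun m hm => h.2 m ?_⟩
  omega

lemma prism_cupd (f g : X → Y) (r : Y → X) (χ : Y → ZMod 2) (a b : ZMod 2) (θ : Cochain X)
    (hθ : θ [] = 0) (hg : ∀ x, r (g x) = x) (ha : ∀ x, χ (f x) = a)
    (hb : ∀ x, χ (g x) = b) : prism f g (cupd χ (pull r θ)) = fun l => (a + b) * θ l := by
  have hrg : ∀ l : List X, (l.map g).map r = l := fun l => by
    simp [List.map_map, Function.comp_def, hg]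
  funext l
  cases l with
  | nil => simp [hθ]
  | cons x l =>
    have h0 : prism f g (fun m => cupd χ (pull r θ) (f x :: m)) l = 0 := by
      cases l with
      | nil => simp
      | cons y l =>
        have h1 : (fun m => cupd χ (pull r θ) (f x :: f y :: m)) = fun _ => 0 := by
          funext m
          rw [cupd_cons, mulF_cons, ha, ha]
          grind
        rw [prism_cons, h1]
        have h2 := prism_eq_zero f g (p := fun _ => True) (φ := fun _ => 0)
          (fun _ _ _ => rfl) l (by simp)
        rw [h2, cupd_cons, mulF_cons, ha, ha]
        grind
    rw [prism_cons, h0, cupd_cons, mulF_cons, ha, hb, pull_apply, List.map_cons, hrg, hg]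
    ring

/-- Restrict a cochain to lists with all entries in `A`. -/
noncomputable def cut (A : Set X) (φ : Cochain X) : Cochain X :=
  open Classical in fun l => if ∀ y ∈ l, y ∈ A then φ l else 0

lemma cut_of_mem {A : Set X} {φ : Cochain X} {l : List X} (h : ∀ y ∈ l, y ∈ A) :
    cut A φ l = φ l := by
  simp only [cut]; exact if_pos h

lemma cut_of_not_mem {A : Set X} {φ : Cochain X} {l : List X} {y : X} (hy : y ∈ l)
    (h : y ∉ A) : cut A φ l = 0 := by
  simp only [cut]; exact if_neg fun h' => h (h' y hy)

lemma cut_nil {A : Set X} {φ : Cochain X} : cut A φ [] = φ [] := cut_of_mem (by simp)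

end AlexanderSpanier

namespace AlexanderSpanier

open Set Topology

variable {X Y Z : Type*} [TopologicalSpace X] [TopologicalSpace Y]

/-- The cochain vanishes on all lists with entries sufficiently near `x`. -/
def LocZero (φ : Cochain X) (x : X) : Prop :=
  ∃ U ∈ 𝓝 x, ∀ l : List X, (∀ y ∈ l, y ∈ U) → φ l = 0

/-- The cochain represents zero in the Alexander–Spanier complex. -/
def LZ (φ : Cochain X) : Prop := ∀ x, LocZero φ x

lemma locZero_zero (x : X) : LocZero (0 : Cochain X) x := ⟨univ, Filter.univ_mem, fun _ _ => rfl⟩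

lemma lz_zero : LZ (0 : Cochain X) := locZero_zero

lemma LocZero.add {φ ψ : Cochain X} {x : X} (h : LocZero φ x) (h' : LocZero ψ x) :
    LocZero (φ + ψ) x := by
  obtain ⟨U, hU, h⟩ := h
  obtain ⟨V, hV, h'⟩ := h'
  refine ⟨U ∩ V, Filter.inter_mem hU hV, fun l hl => ?_⟩
  rw [Pi.add_apply, h l fun y hy => (hl y hy).1, h' l fun y hy => (hl y hy).2, add_zero]

lemma LocZero.sum {ι : Type*} {s : Finset ι} {φ : ι → Cochain X} {x : X}
    (h : ∀ i ∈ s, LocZero (φ i) x) : LocZero (∑ i ∈ s, φ i) x := by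
  classical
  induction s using Finset.induction_on with
  | empty => exact locZero_zero x
  | insert a s ha ih =>
    rw [Finset.sum_insert ha]
    exact (h a (by simp)).add (ih fun i hi => h i (by simp [hi]))

lemma LocZero.d {φ : Cochain X} {x : X} (h : LocZero φ x) : LocZero (d φ) x := by
  obtain ⟨U, hU, h⟩ := h
  exact ⟨U, hU, d_eq_zero h⟩

lemma LocZero.mulF {φ : Cochain X} {x : X} (h : LocZero φ x) (χ : X → ZMod 2) :
    LocZero (mulF χ φ) x := by
  obtain ⟨U, hU, h⟩ := h
  refine ⟨U, hU, fun l hl => ?_⟩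
  cases l with
  | nil => rfl
  | cons y l => rw [mulF_cons, h _ hl, mul_zero]

lemma LocZero.cupd {φ : Cochain X} {x : X} (h : LocZero φ x) (χ : X → ZMod 2) :
    LocZero (cupd χ φ) x := by
  have h1 := d_mulF χ φ
  have h2 : AlexanderSpanier.cupd χ φ = AlexanderSpanier.d (AlexanderSpanier.mulF χ φ) +
    AlexanderSpanier.mulF χ (AlexanderSpanier.d φ) := by grind
  rw [h2]
  exact (h.mulF χ).d.add (h.d.mulF χ)

lemma LocZero.comp {φ : Cochain X} {x : X} (h : LocZero φ x) (k : ℕ) :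
    LocZero (comp k φ) x := by
  obtain ⟨U, hU, h⟩ := h
  refine ⟨U, hU, fun l hl => ?_⟩
  simp [AlexanderSpanier.comp, h l hl]

lemma locZero_cupd_of_const {φ : Cochain X} {x : X} {χ : X → ZMod 2} (hφ : φ [] = 0)
    (h : ∀ᶠ y in 𝓝 x, χ y = χ x) : LocZero (cupd χ φ) x := by
  refine ⟨_, h, fun l hl => ?_⟩
  cases l with
  | nil => rfl
  | cons y l =>
    rw [List.forall_mem_cons] at hl
    cases l with
    | nil => simp [cupd_cons, hφ]
    | cons z l =>
      rw [List.forall_mem_cons] at hl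
      rw [cupd_cons, mulF_cons, show χ z = χ x from hl.2.1, show χ y = χ x from hl.1]
      grind

lemma LocZero.pull {φ : Cochain Y} {f : X → Y} {x : X} (h : LocZero φ (f x))
    (hf : ContinuousAt f x) : LocZero (pull f φ) x := by
  obtain ⟨U, hU, h⟩ := h
  refine ⟨f ⁻¹' U, hf hU, fun l hl => h _ fun y hy => ?_⟩
  obtain ⟨z, hz, rfl⟩ := List.mem_map.1 hy
  exact hl z hz

lemma LZ.add {φ ψ : Cochain X} (h : LZ φ) (h' : LZ ψ) : LZ (φ + ψ) := fun x => (h x).add (h' x)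

lemma LZ.d {φ : Cochain X} (h : LZ φ) : LZ (d φ) := fun x => (h x).d

lemma LZ.pull {φ : Cochain Y} (h : LZ φ) {f : X → Y} (hf : Continuous f) : LZ (pull f φ) :=
  fun x => (h (f x)).pull hf.continuousAt

/-- The cochain has compact support contained in `W`. -/
def CS (W : Set X) (φ : Cochain X) : Prop :=
  ∃ K, IsCompact K ∧ K ⊆ W ∧ ∀ x ∉ K, LocZero φ x

lemma CS.mono {W W' : Set X} {φ : Cochain X} (h : CS W φ) (hW : W ⊆ W') : CS W' φ := by
  obtain ⟨K, hK, hKW, h⟩ := h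
  exact ⟨K, hK, hKW.trans hW, h⟩

lemma LZ.cs {φ : Cochain X} (h : LZ φ) (W : Set X) : CS W φ :=
  ⟨∅, isCompact_empty, empty_subset _, fun x _ => h x⟩

lemma CS.add {W : Set X} {φ ψ : Cochain X} (h : CS W φ) (h' : CS W ψ) : CS W (φ + ψ) := by
  obtain ⟨K, hK, hKW, h⟩ := h
  obtain ⟨L, hL, hLW, h'⟩ := h'
  refine ⟨K ∪ L, hK.union hL, union_subset hKW hLW, fun x hx => ?_⟩
  rw [mem_union, not_or] at hx
  exact (h x hx.1).add (h' x hx.2)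

lemma CS.of_locZero {W : Set X} {φ ψ : Cochain X} (h' : CS W ψ)
    (h : ∀ x, LocZero ψ x → LocZero φ x) : CS W φ := by
  obtain ⟨K, hK, hKW, h'⟩ := h'
  exact ⟨K, hK, hKW, fun x hx => h x (h' x hx)⟩

lemma CS.comp {W : Set X} {φ : Cochain X} (h : CS W φ) (k : ℕ) : CS W (comp k φ) :=
  h.of_locZero fun _ hx => hx.comp k

lemma CS.pull {W : Set Y} {V : Set X} {φ : Cochain Y} (h : CS W φ) {f : X → Y}
    (hf : Continuous f) (hp : ∀ K ⊆ W, IsCompact K → IsCompact (f ⁻¹' K))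
    (hV : f ⁻¹' W ⊆ V) : CS V (pull f φ) := by
  obtain ⟨K, hK, hKW, h⟩ := h
  exact ⟨f ⁻¹' K, hp K hKW hK, (preimage_mono hKW).trans hV,
    fun x hx => (h _ hx).pull hf.continuousAt⟩

/-- The class of the cochain vanishes in the `τ`-invariant cohomology with compact supports
in `W`. -/
def NullI (τ : X → X) (W : Set X) (φ : Cochain X) : Prop :=
  ∃ ψ, ψ [] = 0 ∧ CS W ψ ∧ pull τ ψ = ψ ∧ LZ (φ + d ψ)

/-- The class of the cochain vanishes in the cohomology with compact supports in `W`. -/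
abbrev Null (W : Set X) (φ : Cochain X) : Prop := NullI id W φ

section NullI

variable {τ : X → X} {W W' : Set X} {φ ψ : Cochain X}

lemma Null.intro (h0 : ψ [] = 0) (h1 : CS W ψ) (h2 : LZ (φ + d ψ)) : Null W φ :=
  ⟨ψ, h0, h1, pull_id ψ, h2⟩

lemma NullI.mono (h : NullI τ W φ) (hW : W ⊆ W') : NullI τ W' φ := by
  obtain ⟨ψ, h0, h1, h2, h3⟩ := h
  exact ⟨ψ, h0, h1.mono hW, h2, h3⟩

lemma NullI.add (h : NullI τ W φ) (h' : NullI τ W ψ) : NullI τ W (φ + ψ) := by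
  obtain ⟨α, h0, h1, h2, h3⟩ := h
  obtain ⟨β, h0', h1', h2', h3'⟩ := h'
  refine ⟨α + β, by simp [h0, h0'], h1.add h1', by simp [h2, h2'], ?_⟩
  have := h3.add h3'
  rwa [show φ + d α + (ψ + d β) = φ + ψ + (d α + d β) by abel, ← d_add] at this

lemma NullI.of_lz (h : LZ φ) : NullI τ W φ :=
  ⟨0, rfl, lz_zero.cs W, rfl, by simpa using h⟩

lemma NullI.congr (h : NullI τ W (φ + ψ)) (h' : NullI τ W ψ) : NullI τ W φ := by
  have := h.add h'
  rwa [show φ + ψ + ψ = φ by grind] at this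

lemma Null.congr_right (h : Null W (φ + ψ)) (h' : Null W φ) : Null W ψ := by
  have := h.add h'
  rwa [show φ + ψ + φ = ψ by grind] at this

lemma Null.of_d (h0 : ψ [] = 0) (h : CS W ψ) : Null W (d ψ) :=
  .intro h0 h (by rw [show d ψ + d ψ = 0 by grind]; exact lz_zero)

lemma NullI.exists_deg {k : ℕ} (h : NullI τ W φ) (hφ : Deg k φ) :
    ∃ ψ, Deg (k - 1) ψ ∧ CS W ψ ∧ pull τ ψ = ψ ∧ LZ (φ + AlexanderSpanier.d ψ) := by
  cases k with
  | zero =>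
    rw [hφ.zero_eq]
    exact ⟨0, deg_zero _, lz_zero.cs W, rfl, by simpa using lz_zero⟩
  | succ k =>
    obtain ⟨ψ, h0, h1, h2, h3⟩ := h
    refine ⟨comp k ψ, deg_comp h0, h1.comp k, ?_, fun x => ?_⟩
    · funext l
      have := congrFun h2 l
      simp only [pull_apply] at this
      simp [pull_apply, comp, this]
    · have h4 : φ + d (comp k ψ) = comp (k + 1) (φ + d ψ) := by
        rw [d_comp]
        nth_rw 1 [← comp_eq hφ]
        funext l
        simp only [comp, Pi.add_apply]
        split_ifs <;> simp
      rw [h4]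
      exact (h3 x).comp _

end NullI

lemma Null.pull {W : Set Y} {V : Set X} {φ : Cochain Y} (h : Null W φ) {f : X → Y}
    (hf : Continuous f) (hp : ∀ K ⊆ W, IsCompact K → IsCompact (f ⁻¹' K))
    (hV : f ⁻¹' W ⊆ V) : Null V (pull f φ) := by
  obtain ⟨ψ, h0, h1, _, h3⟩ := h
  refine .intro (ψ := AlexanderSpanier.pull f ψ) h0 (h1.pull hf hp hV) ?_
  rw [d_pull, ← pull_add]
  exact h3.pull hf

/-- A `τ`-invariant cocycle with compact support in `W`, supported on lists of length `k`. -/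
structure Cyc (τ : X → X) (W : Set X) (k : ℕ) (φ : Cochain X) : Prop where
  cs : CS W φ
  deg : Deg k φ
  inv : pull τ φ = φ
  lz : LZ (d φ)

lemma Cyc.mono {τ : X → X} {W W' : Set X} {k : ℕ} {φ : Cochain X} (h : Cyc τ W k φ)
    (hW : W ⊆ W') : Cyc τ W' k φ := ⟨h.cs.mono hW, h.deg, h.inv, h.lz⟩

lemma Cyc.add {τ : X → X} {W : Set X} {k : ℕ} {φ ψ : Cochain X} (h : Cyc τ W k φ)
    (h' : Cyc τ W k ψ) : Cyc τ W k (φ + ψ) :=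
  ⟨h.cs.add h'.cs, h.deg.add h'.deg, by rw [pull_add, h.inv, h'.inv],
    by rw [d_add]; exact h.lz.add h'.lz⟩

lemma Cyc.pull {W : Set Y} {V : Set X} {k : ℕ} {φ : Cochain Y} (h : Cyc _root_.id W k φ)
    {f : X → Y} (hf : Continuous f) (hp : ∀ K ⊆ W, IsCompact K → IsCompact (f ⁻¹' K))
    (hV : f ⁻¹' W ⊆ V) : Cyc _root_.id V k (pull f φ) :=
  ⟨h.cs.pull hf hp hV, h.deg.pull f, pull_id _, by rw [d_pull]; exact h.lz.pull hf⟩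

section cut

variable {A : Set X} {φ : Cochain X} {x : X}

lemma Deg.cut {X : Type*} {φ : Cochain X} {k : ℕ} (h : Deg k φ) (A : Set X) : Deg k (cut A φ) :=
  ⟨by rw [cut_nil, h.1], fun l hl => by simp [AlexanderSpanier.cut, h.2 l hl]⟩

lemma locZero_add_cut (h : A ∈ 𝓝 x) : LocZero (φ + cut A φ) x :=
  ⟨A, h, fun l hl => by rw [Pi.add_apply, cut_of_mem hl]; grind⟩

lemma LocZero.cut (h : LocZero φ x) : LocZero (cut A φ) x := by
  obtain ⟨U, hU, h⟩ := h
  exact ⟨U, hU, fun l hl => by simp [AlexanderSpanier.cut, h l hl]⟩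

/-- The cochain vanishes on lists that are empty or have an entry outside `K`. -/
def StrictOn (K : Set X) (φ : Cochain X) : Prop := φ [] = 0 ∧ ∀ l, ∀ y ∈ l, y ∉ K → φ l = 0

lemma strictOn_cut {X : Type*} {A : Set X} {φ : Cochain X} (h : φ [] = 0) : StrictOn A (cut A φ) :=
  ⟨by rw [cut_nil, h], fun _ _ hy h' => cut_of_not_mem hy h'⟩

lemma StrictOn.locZero_of_nhds {K : Set X} (h : StrictOn K φ) (hx : Kᶜ ∈ 𝓝 x) : LocZero φ x := by
  refine ⟨Kᶜ, hx, fun l hl => ?_⟩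
  cases l with
  | nil => exact h.1
  | cons y l => exact h.2 _ y (by simp) (hl y (by simp))

lemma StrictOn.locZero {K : Set X} (h : StrictOn K φ) (hK : IsClosed K) (hx : x ∉ K) :
    LocZero φ x := h.locZero_of_nhds (hK.isOpen_compl.mem_nhds hx)

lemma locZero_cut (h : φ [] = 0) (hx : x ∉ closure A) : LocZero (cut A φ) x :=
  (strictOn_cut h).locZero_of_nhds
    (Filter.mem_of_superset (isClosed_closure.isOpen_compl.mem_nhds hx)
      (compl_subset_compl.2 subset_closure))

lemma CS.exists_cut [LocallyCompactSpace X] [R1Space X] {W : Set X} (hW : IsOpen W)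
    (h : CS W φ) : ∃ K, IsCompact K ∧ K ⊆ W ∧ LZ (φ + AlexanderSpanier.cut K φ) := by
  obtain ⟨K, hK, hKW, h⟩ := h
  obtain ⟨L, hL, hKL, hLW⟩ := exists_compact_between hK hW hKW
  refine ⟨L, hL, hLW, fun x => ?_⟩
  by_cases hx : x ∈ K
  · exact locZero_add_cut (mem_interior_iff_mem_nhds.1 (hKL hx))
  · exact (h x hx).add (h x hx).cut

end cut

/-- Uniform vanishing near a compact set. -/
lemma exists_uniform {M : Type*} [PseudoMetricSpace M] {κ : Cochain M} {C : Set M}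
    (hC : IsCompact C) (h : ∀ x ∈ C, LocZero κ x) :
    ∃ ε > 0, ∀ x ∈ C, ∀ l : List M, (∀ y ∈ l, dist y x < ε) → κ l = 0 := by
  choose! U hU hU' using h
  obtain ⟨ε, hε, h⟩ := lebesgue_number_lemma_of_metric (c := fun x : C => interior (U x)) hC
    (fun _ => isOpen_interior)
    (fun x hx => mem_iUnion.2 ⟨⟨x, hx⟩, mem_interior_iff_mem_nhds.2 (hU x hx)⟩)
  refine ⟨ε, hε, fun x hx l hl => ?_⟩
  obtain ⟨z, hz⟩ := h x hx
  exact hU' z z.2 l fun y hy => interior_subset (hz (hl y hy))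

/-- For a cocycle strictly supported on a compact set, the coboundary vanishes on all lists
whose entries are uniformly close. -/
lemma exists_uniform_cocycle {M : Type*} [PseudoMetricSpace M] {φ : Cochain M} {K : Set M}
    (hK : IsCompact K) (hφ : StrictOn K φ) (h : LZ (d φ)) :
    ∃ ε > 0, ∀ x, ∀ l : List M, (∀ y ∈ l, dist y x < ε) → d φ l = 0 := by
  obtain ⟨ε, hε, h⟩ := exists_uniform hK fun x _ => h x
  refine ⟨ε / 2, by positivity, fun x l hl => ?_⟩
  by_cases hl' : ∃ z ∈ l, z ∈ K
  · obtain ⟨z, hz, hzK⟩ := hl'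
    refine h z hzK l fun y hy => ?_
    have h1 := hl y hy
    have h2 := hl z hz
    have h3 := dist_triangle_right y z x
    linarith
  · push Not at hl'
    refine d_eq_zero (p := fun y => y ∉ K) (fun m hm => ?_) l hl'
    cases m with
    | nil => exact hφ.1
    | cons y m => exact hφ.2 _ y (by simp) (hm y (by simp))

section MayerVietoris

variable {τ : X → X} {A B : Set X} {k : ℕ} {R : Cochain X → Prop}

theorem mayerVietoris [T2Space X] [LocallyCompactSpace X] (hτ : Continuous τ)
    (hττ : Function.Involutive τ) (hA : IsOpen A) (hAτ : ∀ x ∈ A, τ x ∈ A)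
    (hadd : ∀ φ ψ, R φ → R ψ → R (φ + ψ))
    (hAB : ∀ κ, Cyc τ (A ∩ B) (k + 1) κ → NullI τ (A ∩ B) κ)
    (hRA : ∀ φ, Cyc τ A k φ → R φ) (hRB : ∀ φ, Cyc τ B k φ → R φ)
    (hB : IsOpen B) (φ : Cochain X) (hφ : Cyc τ (A ∪ B) k φ) : R φ := by
  classical
  obtain ⟨K, hK, hKAB, hKφ⟩ := hφ.cs
  have hKB : K \ B ⊆ A := fun x hx => (hKAB hx.1).resolve_right hx.2
  obtain ⟨L, hL, hKL, hLA⟩ := exists_compact_between (hK.diff hB) hA hKB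
  let O : Set X := interior L ∪ τ ⁻¹' interior L
  let C : Set X := L ∪ τ ⁻¹' L
  have hτL : IsCompact (τ ⁻¹' L) := by
    have : τ ⁻¹' L = τ '' L := by
      rw [Set.image_eq_preimage_of_inverse hττ.leftInverse hττ.rightInverse]
    rw [this]
    exact hL.image hτ
  have hC : IsCompact C := hL.union hτL
  have hCA : C ⊆ A := by
    rintro x (hx | hx)
    · exact hLA hx
    · have := hAτ _ (hLA hx)
      rwa [hττ x] at this
  have hO : IsOpen O := isOpen_interior.union (isOpen_interior.preimage hτ)
  have hOC : O ⊆ C := union_subset_union interior_subset (preimage_mono interior_subset)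
  have hKO : K \ B ⊆ O := hKL.trans subset_union_left
  let χ : X → ZMod 2 := fun x => if x ∈ O then 1 else 0
  have hχτ : χ ∘ τ = χ := by
    funext x
    have : τ x ∈ O ↔ x ∈ O := by
      simp only [O, mem_union, mem_preimage, hττ x]
      tauto
    simp [χ, this]
  let φ₁ := mulF χ φ
  have hφ₁τ : pull τ φ₁ = φ₁ := by rw [pull_mulF, hχτ, hφ.inv]
  have hφ₁C : ∀ x ∉ C, LocZero φ₁ x := by
    intro x hx
    refine ⟨Cᶜ, hC.isClosed.isOpen_compl.mem_nhds hx, fun l hl => ?_⟩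
    cases l with
    | nil => rfl
    | cons y l =>
      have : y ∉ O := fun h => hl y (by simp) (hOC h)
      rw [show φ₁ (y :: l) = χ y * φ (y :: l) from rfl, show χ y = 0 from if_neg this, zero_mul]
  have hφ₁O : ∀ x ∈ O, LocZero (φ + φ₁) x := by
    intro x hx
    refine ⟨O, hO.mem_nhds hx, fun l hl => ?_⟩
    cases l with
    | nil => simp [φ₁, hφ.deg.1]
    | cons y l =>
      rw [Pi.add_apply, show φ₁ (y :: l) = χ y * φ (y :: l) from rfl,
        show χ y = 1 from if_pos (hl y (by simp))]
      grind
  have hd₁ : Cyc τ (A ∩ B) (k + 1) (d φ₁) := by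
    refine ⟨⟨(K ∩ C) \ O, (hK.inter hC).diff hO, ?_, fun x hx => ?_⟩, (hφ.deg.mulF χ).d, ?_, ?_⟩
    · rintro x ⟨⟨h1, h2⟩, h3⟩
      refine ⟨hCA h2, ?_⟩
      by_contra h4
      exact h3 (hKO ⟨h1, h4⟩)
    · by_cases h1 : x ∈ K
      · by_cases h2 : x ∈ C
        · have h3 : x ∈ O := by
            by_contra h3
            exact hx ⟨⟨h1, h2⟩, h3⟩
          have h4 := (hφ₁O x h3).d.add (hφ.lz x)
          rw [d_add] at h4
          rwa [show d φ + d φ₁ + d φ = d φ₁ by grind] at h4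
        · exact (hφ₁C x h2).d
      · exact ((hKφ x h1).mulF χ).d
    · rw [← d_pull, hφ₁τ]
    · rw [d_d]; exact lz_zero
  obtain ⟨ψ, hψ, hψc, hψτ, hψd⟩ := (hAB _ hd₁).exists_deg hd₁.deg
  rw [Nat.add_sub_cancel] at hψ
  have hψA : CS A ψ := hψc.mono inter_subset_left
  have hψB : CS B ψ := hψc.mono inter_subset_right
  have h1 : Cyc τ A k (φ₁ + ψ) := by
    refine ⟨CS.add ⟨C, hC, hCA, hφ₁C⟩ hψA, (hφ.deg.mulF χ).add hψ, ?_, ?_⟩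
    · rw [pull_add, hφ₁τ, hψτ]
    · rwa [d_add]
  have h2 : Cyc τ B k (φ + φ₁ + ψ) := by
    refine ⟨CS.add ⟨K \ O, hK.diff hO, ?_, fun x hx => ?_⟩ hψB,
      (hφ.deg.add (hφ.deg.mulF χ)).add hψ, ?_, ?_⟩
    · intro x hx
      by_contra h3
      exact hx.2 (hKO ⟨hx.1, h3⟩)
    · by_cases h3 : x ∈ O
      · exact hφ₁O x h3
      · have h4 : x ∉ K := fun h4 => hx ⟨h4, h3⟩
        exact (hKφ x h4).add ((hKφ x h4).mulF χ)
    · rw [pull_add, pull_add, hφ₁τ, hψτ, hφ.inv]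
    · rw [d_add, d_add, add_assoc]
      exact hφ.lz.add hψd
  have := hadd _ _ (hRA _ h1) (hRB _ h2)
  rwa [show φ₁ + ψ + (φ + φ₁ + ψ) = φ by grind] at this

theorem cover_induction [T2Space X] [LocallyCompactSpace X] (hτ : Continuous τ)
    (hττ : Function.Involutive τ) (𝓑 : Set (Set X)) (ho : ∀ B ∈ 𝓑, IsOpen B)
    (hi : ∀ B ∈ 𝓑, ∀ x ∈ B, τ x ∈ B) (hcov : ∀ x, ∃ B ∈ 𝓑, x ∈ B)
    (h0 : ∀ φ, LZ φ → R φ) (hadd : ∀ φ ψ, R φ → R ψ → R (φ + ψ))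
    (hAB : ∀ B ∈ 𝓑, ∀ A, IsOpen A → (∀ x ∈ A, τ x ∈ A) →
      ∀ κ, Cyc τ (A ∩ B) (k + 1) κ → NullI τ (A ∩ B) κ)
    (hRB : ∀ B ∈ 𝓑, ∀ φ, Cyc τ B k φ → R φ) (φ : Cochain X) (hφ : Cyc τ univ k φ) : R φ := by
  classical
  have key : ∀ s : Finset 𝓑, ∀ φ, Cyc τ (⋃ B ∈ s, (B : Set X)) k φ → R φ := by
    intro s
    induction s using Finset.induction_on with
    | empty =>
      intro φ hφ
      obtain ⟨K, _, hK, h⟩ := hφ.cs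
      refine h0 φ fun x => h x fun hx => ?_
      simpa using hK hx
    | insert B s _ ih =>
      intro φ hφ
      rw [Finset.set_biUnion_insert, union_comm] at hφ
      refine mayerVietoris hτ hττ (isOpen_biUnion fun B _ => ho _ B.2) ?_ hadd
        (hAB B B.2 _ (isOpen_biUnion fun B _ => ho _ B.2) ?_) ih (hRB B B.2) (ho B B.2) φ hφ
      all_goals
        intro x hx
        simp only [mem_iUnion] at hx ⊢
        obtain ⟨B', hB', hx⟩ := hx
        exact ⟨B', hB', hi _ B'.2 x hx⟩
  obtain ⟨K, hK, _, hKφ⟩ := hφ.cs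
  obtain ⟨s, hs⟩ := hK.elim_finite_subcover (fun B : 𝓑 => (B : Set X)) (fun B => ho B B.2)
    (fun x _ => by
      obtain ⟨B, hB, hx⟩ := hcov x
      exact mem_iUnion.2 ⟨⟨B, hB⟩, hx⟩)
  exact key s φ ⟨⟨K, hK, hs, hKφ⟩, hφ.deg, hφ.inv, hφ.lz⟩

end MayerVietoris

end AlexanderSpanier

namespace AlexanderSpanier

open Set Topology

variable {X Y Z : Type*}

/-- The sum of the prism operators along a chain of maps. -/
def prismSum (f : ℕ → X → Y) (M : ℕ) (φ : Cochain Y) : Cochain X :=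
  ∑ i ∈ Finset.range M, prism (f i) (f (i + 1)) φ

lemma d_prismSum (f : ℕ → X → Y) (M : ℕ) (φ : Cochain Y) :
    d (prismSum f M φ) + prismSum f M (d φ) = pull (f 0) φ + pull (f M) φ := by
  induction M with
  | zero => simp [prismSum]; grind
  | succ M ih =>
    simp only [prismSum, Finset.sum_range_succ, d_add] at ih ⊢
    have := d_prism (f M) (f (M + 1)) φ
    grind

lemma prismSum_nil (f : ℕ → X → Y) (M : ℕ) (φ : Cochain Y) : prismSum f M φ [] = 0 := by
  simp [prismSum]

lemma prismSum_add (f : ℕ → X → Y) (M : ℕ) (φ ψ : Cochain Y) :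
    prismSum f M (φ + ψ) = prismSum f M φ + prismSum f M ψ := by
  simp [prismSum, prism_add, Finset.sum_add_distrib]

lemma Deg.prismSum {k : ℕ} {φ : Cochain Y} (h : Deg k φ) (f : ℕ → X → Y) (M : ℕ) :
    Deg (k - 1) (prismSum f M φ) := Deg.sum fun _ _ => h.prism _ _

lemma prismSum_congr (f : ℕ → X → Y) (g : ℕ → Z → Y) (r : X → Z) (p : X → Prop)
    (h : ∀ i x, p x → f i x = g i (r x)) (M : ℕ) (φ : Cochain Y) (l : List X)
    (hl : ∀ x ∈ l, p x) : prismSum f M φ l = prismSum g M φ (l.map r) := by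
  simp only [prismSum, Finset.sum_apply]
  refine Finset.sum_congr rfl fun i _ => ?_
  induction l generalizing φ with
  | nil => simp
  | cons x l ih =>
    rw [List.forall_mem_cons] at hl
    rw [List.map_cons, prism_cons, prism_cons, ih _ hl.2, h _ _ hl.1, h _ _ hl.1]
    congr 3
    rw [List.map_map]
    congr 1
    exact List.map_congr_left fun y hy => h _ _ (hl.2 y hy)

section

variable [TopologicalSpace X]

lemma locZero_prismSum [TopologicalSpace Y] {f : ℕ → X → Y} {M : ℕ} {φ : Cochain Y} {K : Set Y}
    {x : X} (hφ : StrictOn K φ) (hK : IsClosed K) (hf : ∀ i ≤ M, ContinuousAt (f i) x)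
    (hx : ∀ i ≤ M, f i x ∉ K) : LocZero (prismSum f M φ) x := by
  refine LocZero.sum fun i hi => ?_
  have hi' : i < M := by simpa using hi
  have h1 := (hf i hi'.le).eventually_mem (hK.isOpen_compl.mem_nhds (hx i hi'.le))
  have h2 := (hf (i + 1) hi').eventually_mem (hK.isOpen_compl.mem_nhds (hx (i + 1) hi'))
  refine ⟨_, h1.and h2, prism_eq_zero _ _ fun l hl hl' => ?_⟩
  obtain ⟨y, m, rfl⟩ := List.exists_cons_of_ne_nil hl
  refine hφ.2 _ y (by simp) ?_
  obtain ⟨z, hz, rfl | rfl⟩ := hl' y (by simp)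
  · exact hz.1
  · exact hz.2

lemma locZero_prismSum_of_small [PseudoMetricSpace Y] {f : ℕ → X → Y} {M : ℕ} {κ : Cochain Y}
    {ε : ℝ} {x : X} (hf : ∀ i ≤ M, ContinuousAt (f i) x)
    (hκ : ∀ i < M, ∀ l : List Y, (∀ y ∈ l, dist y (f i x) < ε) → κ l = 0)
    (hx : ∀ i < M, dist (f (i + 1) x) (f i x) < ε) : LocZero (prismSum f M κ) x := by
  refine LocZero.sum fun i hi => ?_
  have hi' : i < M := by simpa using hi
  have hε : 0 < ε := dist_nonneg.trans_lt (hx i hi')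
  have h1 := (hf i hi'.le).eventually_mem (Metric.ball_mem_nhds _ hε)
  have h2 := (hf (i + 1) hi').eventually_mem (Metric.isOpen_ball.mem_nhds (hx i hi'))
  refine ⟨_, h1.and h2, prism_eq_zero _ _ fun l _ hl' => hκ i hi' l fun y hy => ?_⟩
  obtain ⟨z, hz, rfl | rfl⟩ := hl' y hy
  · exact hz.1
  · exact hz.2

/-- A uniformly continuous proper homotopy. -/
structure PropHomotopy [PseudoMetricSpace Y] (H : ℝ → X → Y) : Prop where
  cont : ∀ t ∈ Icc (0 : ℝ) 1, Continuous (H t)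
  unif : ∀ ε > 0, ∃ δ > 0, ∀ s ∈ Icc (0 : ℝ) 1, ∀ t ∈ Icc (0 : ℝ) 1, |s - t| < δ →
    ∀ x, dist (H s x) (H t x) < ε
  proper : ∀ K, IsCompact K → ∃ C, IsCompact C ∧ ∀ x ∉ C, ∀ t ∈ Icc (0 : ℝ) 1, H t x ∉ K

lemma CS.lz_d_cut {W K : Set X} {k : ℕ} {φ : Cochain X} (h : Cyc id W k φ)
    (h' : LZ (φ + cut K φ)) : LZ (AlexanderSpanier.d (cut K φ)) := by
  have := h.lz.add h'.d
  rwa [d_add, ← add_assoc, show AlexanderSpanier.d φ + AlexanderSpanier.d φ = 0 by grind,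
    zero_add] at this

theorem PropHomotopy.null [MetricSpace Y] [LocallyCompactSpace Y] {H : ℝ → X → Y}
    (hH : PropHomotopy H) {k : ℕ} {φ : Cochain Y} (hφ : Cyc id univ k φ) :
    Null univ (pull (H 0) φ + pull (H 1) φ) := by
  obtain ⟨K, hK, -, hKφ⟩ := hφ.cs.exists_cut isOpen_univ
  have hs : StrictOn K (cut K φ) := strictOn_cut hφ.deg.1
  obtain ⟨ε, hε, hd⟩ := exists_uniform_cocycle hK hs (CS.lz_d_cut hφ hKφ)
  obtain ⟨δ, hδ, hu⟩ := hH.unif ε hε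
  obtain ⟨M, hM⟩ := exists_nat_one_div_lt hδ
  obtain ⟨C, hC, hCK⟩ := hH.proper K hK
  have hM0 : (0 : ℝ) < M + 1 := by positivity
  have ht : ∀ i ≤ M + 1, (i : ℝ) / (M + 1) ∈ Icc (0 : ℝ) 1 := by
    intro i hi
    have : (i : ℝ) ≤ M + 1 := by exact_mod_cast hi
    exact ⟨by positivity, by rwa [div_le_one hM0]⟩
  let f : ℕ → X → Y := fun i => H (i / (M + 1))
  have hf0 : f 0 = H 0 := by simp [f]
  have hf1 : f (M + 1) = H 1 := by
    simp only [f]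
    congr 1
    push_cast
    field_simp
  have hfc : ∀ i ≤ M + 1, Continuous (f i) := fun i hi => hH.cont _ (ht i hi)
  have key := d_prismSum f (M + 1) (cut K φ)
  have h1 : LZ (prismSum f (M + 1) (d (cut K φ))) := by
    refine fun x => locZero_prismSum_of_small (ε := ε) (fun i hi => (hfc i hi).continuousAt)
      (fun i _ l hl => hd _ l hl) fun i hi => ?_
    refine hu _ (ht (i + 1) hi) _ (ht i hi.le) ?_ x
    rw [← sub_div]
    push_cast
    rw [show (i : ℝ) + 1 - i = 1 by ring, abs_of_pos (by positivity)]
    exact hM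
  have h2 : Null univ (d (prismSum f (M + 1) (cut K φ))) := by
    refine Null.of_d (prismSum_nil _ _ _) ⟨C, hC, subset_univ _, fun x hx => ?_⟩
    exact locZero_prismSum hs hK.isClosed (fun i hi => (hfc i hi).continuousAt)
      fun i hi => hCK x hx _ (ht i hi)
  have h0 : (0 : ℝ) ∈ Icc (0 : ℝ) 1 := by simp
  have h0' : (1 : ℝ) ∈ Icc (0 : ℝ) 1 := by simp
  have h3 := (hKφ.pull (hH.cont 0 h0)).add (hKφ.pull (hH.cont 1 h0'))
  have h4 := (h2.add (NullI.of_lz h1)).add (NullI.of_lz h3)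
  rw [key, hf0, hf1, pull_add, pull_add] at h4
  have h5 : ∀ a b a' b' : Cochain X, a' + b' + (a + a' + (b + b')) = a + b := by
    intro a b a' b'; grind
  rwa [h5] at h4

end

/-- The cochain dual to a point of `ℝⁿ`. -/
noncomputable def pointClass (n : ℕ) : Cochain (Fin n → ℝ) :=
  cupF n fun k y => if 0 < y k then 1 else 0

lemma pointClass_succ (n : ℕ) : pointClass (n + 1) =
    cupd (fun y => if 0 < y 0 then 1 else 0) (pull Fin.tail (pointClass n)) := by
  rw [pointClass, cupF, pointClass, pull_cupF]
  rfl

lemma locZero_cupF [TopologicalSpace X] {n : ℕ} {s : Fin n → X → ZMod 2} {x : X} (k : Fin n)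
    (h : ∀ᶠ y in 𝓝 x, s k y = s k x) : LocZero (cupF n s) x := by
  induction n with
  | zero => exact k.elim0
  | succ n ih =>
    rw [cupF]
    induction k using Fin.cases with
    | zero => exact locZero_cupd_of_const (deg_cupF _ _).1 h
    | succ k => exact (ih k h).cupd _

lemma eventually_indicator {x : X} [TopologicalSpace X] {f : X → ℝ} (hf : ContinuousAt f x)
    (hx : f x ≠ 0) :
    ∀ᶠ y in 𝓝 x, (if 0 < f y then 1 else 0 : ZMod 2) = if 0 < f x then 1 else 0 := by
  rcases hx.lt_or_gt with h | h
  · filter_upwards [hf.eventually_lt_const h] with y hy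
    rw [if_neg hy.not_gt, if_neg h.not_gt]
  · filter_upwards [hf.eventually_const_lt h] with y hy
    rw [if_pos hy, if_pos h]

lemma locZero_pointClass {n : ℕ} {x : Fin n → ℝ} (hx : x ≠ 0) : LocZero (pointClass n) x := by
  obtain ⟨k, hk⟩ := Function.ne_iff.1 hx
  exact locZero_cupF k (eventually_indicator (continuous_apply k).continuousAt hk)

lemma deg_pointClass (n : ℕ) : Deg (n + 1) (pointClass n) := deg_cupF _ _

lemma cyc_pointClass (n : ℕ) {W : Set (Fin n → ℝ)} (hW : 0 ∈ W) :
    Cyc id W (n + 1) (pointClass n) :=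
  ⟨⟨{0}, isCompact_singleton, by simpa using hW, fun _ hx => locZero_pointClass hx⟩,
    deg_pointClass n, pull_id _, by rw [pointClass, d_cupF]; exact lz_zero⟩

lemma cons_mem_closedBall {n : ℕ} {L : ℝ} (hL : 0 ≤ L) (a : ℝ) (x : Fin n → ℝ) :
    (Fin.cons a x : Fin (n + 1) → ℝ) ∈ Metric.closedBall 0 L ↔
      |a| ≤ L ∧ x ∈ Metric.closedBall 0 L := by
  simp [pi_norm_le_iff_of_nonneg hL, Fin.forall_fin_succ]

lemma dist_cons_lt {n : ℕ} {ε : ℝ} (hε : 0 < ε) {a b : ℝ} (x : Fin n → ℝ) (h : |a - b| < ε) :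
    dist (Fin.cons a x : Fin (n + 1) → ℝ) (Fin.cons b x) < ε := by
  rw [dist_pi_lt_iff hε, Fin.forall_fin_succ]
  simpa [Real.dist_eq, hε] using h

lemma StrictOn.mono {K L : Set X} {φ : Cochain X} (h : StrictOn K φ) (hKL : K ⊆ L) :
    StrictOn L φ := ⟨h.1, fun l y hy hyL => h.2 l y hy fun hyK => hyL (hKL hyK)⟩

/-- The classification of compactly supported classes on `ℝ⁰`. -/
lemma null_or_of_euclidean_zero {k : ℕ} {φ : Cochain (Fin 0 → ℝ)} (hφ : Cyc id univ k φ) :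
    Null univ φ ∨ k = 0 + 1 ∧ Null univ (φ + pointClass 0) := by
  have hd : d φ = 0 := by
    obtain ⟨U, hU, h⟩ := hφ.lz 0
    funext l
    exact h l fun y _ => by rw [Subsingleton.elim y 0]; exact mem_of_mem_nhds hU
  by_cases hk : k = 1
  · subst hk
    have key : ∀ ψ : Cochain (Fin 0 → ℝ), Deg 1 ψ → ψ [0] = 0 → ψ = 0 := by
      intro ψ hψ h0
      funext l
      by_cases hl : l.length = 1
      · obtain ⟨y, rfl⟩ := List.length_eq_one_iff.1 hl
        rwa [Subsingleton.elim y 0]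
      · exact hψ.2 l hl
    by_cases h0 : φ [0] = 0
    · left
      rw [key φ hφ.deg h0]
      exact NullI.of_lz lz_zero
    · right
      refine ⟨rfl, ?_⟩
      rw [key (φ + pointClass 0) (hφ.deg.add (deg_pointClass 0))]
      · exact NullI.of_lz lz_zero
      · have : pointClass 0 [0] = 1 := rfl
        rw [Pi.add_apply, this]
        generalize φ [0] = a at h0
        revert a
        decide
  · left
    refine .intro (ψ := fun l => φ (0 :: l)) (hφ.deg.2 _ (by simpa using Ne.symm hk))
      ⟨univ, isCompact_univ, subset_rfl, by simp⟩ ?_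
    have : φ + d (fun l => φ (0 :: l)) = 0 := by
      funext l
      have := congrFun hd (0 :: l)
      rwa [d_cons] at this
    rw [this]
    exact lz_zero

end AlexanderSpanier

namespace AlexanderSpanier

open Set Topology

variable {X Y Z : Type*}

lemma Cyc.exists_strict [TopologicalSpace X] [T2Space X] [LocallyCompactSpace X] {W : Set X}
    {k : ℕ} {φ : Cochain X} (h : Cyc id W k φ) (hW : IsOpen W) :
    ∃ K φ', IsCompact K ∧ K ⊆ W ∧ StrictOn K φ' ∧ Cyc id W k φ' ∧ LZ (φ + φ') := by
  obtain ⟨K, hK, hKW, hφ⟩ := h.cs.exists_cut hW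
  have hs := strictOn_cut (A := K) h.deg.1
  exact ⟨K, cut K φ, hK, hKW, hs, ⟨⟨K, hK, hKW, fun x hx => hs.locZero hK.isClosed hx⟩,
    h.deg.cut K, pull_id _, CS.lz_d_cut h hφ⟩, hφ⟩

lemma continuous_cons_left (n : ℕ) (a : ℝ) :
    Continuous fun x : Fin n → ℝ => (Fin.cons a x : Fin (n + 1) → ℝ) :=
  continuous_pi fun i => Fin.cases (by simpa using continuous_const)
    (fun i => by simpa using continuous_apply i) i

lemma continuous_tail (n : ℕ) : Continuous (Fin.tail : (Fin (n + 1) → ℝ) → Fin n → ℝ) :=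
  continuous_pi fun i => continuous_apply i.succ

lemma continuous_sweep (n : ℕ) (a : ℝ) : Continuous fun y : Fin (n + 1) → ℝ =>
    (Fin.cons (max (y 0) a) (Fin.tail y) : Fin (n + 1) → ℝ) :=
  continuous_pi fun i => Fin.cases
    (by simpa using (continuous_apply 0).max continuous_const)
    (fun i => by simpa [Fin.tail] using continuous_apply i.succ) i

lemma mem_closedBall_iff_tail {n : ℕ} {L : ℝ} (hL : 0 ≤ L) (y : Fin (n + 1) → ℝ) :
    y ∈ Metric.closedBall 0 L ↔ |y 0| ≤ L ∧ Fin.tail y ∈ Metric.closedBall 0 L := by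
  rw [← cons_mem_closedBall hL, Fin.cons_self_tail]

lemma null_cupd_tail {n : ℕ} {α : Cochain (Fin n → ℝ)} (h : Null univ α) :
    Null univ (cupd (fun y : Fin (n + 1) → ℝ => if 0 < y 0 then 1 else 0)
      (pull Fin.tail α)) := by
  obtain ⟨ψ, h0, ⟨K, hK, -, hψ⟩, -, h2⟩ := h
  have hcs : CS univ (cupd (fun y : Fin (n + 1) → ℝ => if 0 < y 0 then (1 : ZMod 2) else 0)
      (pull Fin.tail ψ)) := by
    refine ⟨_, hK.image (continuous_cons_left n 0), subset_univ _, fun y hy => ?_⟩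
    by_cases hy0 : y 0 = 0
    · refine ((hψ (Fin.tail y) fun h => hy ⟨_, h, ?_⟩).pull
        (continuous_tail n).continuousAt).cupd _
      rw [← hy0]
      exact Fin.cons_self_tail y
    · exact locZero_cupd_of_const h0
        (eventually_indicator (continuous_apply 0).continuousAt hy0)
  refine .intro (cupd_nil _ _) hcs ?_
  rw [d_cupd, d_pull, ← cupd_add, ← pull_add]
  exact fun y => ((h2 _).pull (continuous_tail n).continuousAt).cupd _

lemma exists_sweep {R ε : ℝ} (hR : 0 ≤ R) (hε : 0 < ε) : ∃ (M : ℕ) (t : ℕ → ℝ),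
    t 0 = -R ∧ R < t M ∧ (∀ m, |t (m + 1) - t m| < ε) ∧ ∀ m, -R ≤ t m ∧ t m ≤ R + 1 := by
  obtain ⟨M, hM⟩ := exists_nat_gt (2 * R / (ε / 2))
  refine ⟨M, fun m => min (-R + m * (ε / 2)) (R + 1), ?_, ?_, fun m => ?_, fun m => ⟨?_, ?_⟩⟩
  · beta_reduce
    rw [min_eq_left] <;> simp
    linarith
  · rw [div_lt_iff₀ (by positivity)] at hM
    rw [lt_min_iff]
    constructor <;> linarith
  · refine (abs_min_sub_min_le_max _ _ _ _).trans_lt ?_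
    push_cast
    rw [show -R + ((m : ℝ) + 1) * (ε / 2) - (-R + m * (ε / 2)) = ε / 2 by ring, sub_self,
      abs_of_pos (by positivity : 0 < ε / 2), abs_zero, max_lt_iff]
    constructor <;> linarith
  · have : 0 ≤ (m : ℝ) * (ε / 2) := by positivity
    rw [le_min_iff]
    constructor <;> linarith
  · exact min_le_right _ _

/-- Desuspension: every compactly supported class on `ℝⁿ⁺¹` is the suspension of a class on
`ℝⁿ`. -/
lemma exists_desuspension {n k : ℕ} {φ : Cochain (Fin (n + 1) → ℝ)} (hφ : Cyc id univ k φ) :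
    ∃ θ : Cochain (Fin n → ℝ), Cyc id univ (k - 1) θ ∧
      Null univ (φ + cupd (fun y => if 0 < y 0 then 1 else 0) (pull Fin.tail θ)) := by
  obtain ⟨K, φ', hK, -, hs, hφ', hφφ'⟩ := hφ.exists_strict isOpen_univ
  obtain ⟨L, hL, hKL⟩ := hK.isBounded.subset_closedBall_lt 0 0
  replace hs := hs.mono hKL
  have hcl : IsClosed (Metric.closedBall (0 : Fin (n + 1) → ℝ) L) := Metric.isClosed_closedBall
  obtain ⟨ε, hε, hd⟩ := exists_uniform_cocycle (isCompact_closedBall _ _) hs hφ'.lz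
  obtain ⟨M, t, ht0, htM, htε, htL⟩ := exists_sweep (R := L + 1) (by linarith) hε
  let f : ℕ → (Fin (n + 1) → ℝ) → (Fin (n + 1) → ℝ) :=
    fun m y => Fin.cons (max (y 0) (t m)) (Fin.tail y)
  let c : ℕ → (Fin n → ℝ) → (Fin (n + 1) → ℝ) := fun m x => Fin.cons (t m) x
  have hf : ∀ m, Continuous (f m) := fun m => continuous_sweep n (t m)
  have hc : ∀ m, Continuous (c m) := fun m => continuous_cons_left n (t m)
  have hfmem : ∀ m y, f m y ∈ Metric.closedBall 0 L ↔
      |max (y 0) (t m)| ≤ L ∧ Fin.tail y ∈ Metric.closedBall 0 L :=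
    fun m y => cons_mem_closedBall hL.le _ _
  have hcmem : ∀ m x, c m x ∈ Metric.closedBall 0 L ↔
      |t m| ≤ L ∧ x ∈ Metric.closedBall 0 L :=
    fun m y => cons_mem_closedBall hL.le _ _
  set ψ := prismSum f M φ' with hψdef
  set θ := prismSum c M φ' with hθdef
  have hψk := d_prismSum f M φ'
  have hθk := d_prismSum c M φ'
  have hψ1 : LZ (prismSum f M (d φ')) := fun y => locZero_prismSum_of_small
    (fun i _ => (hf i).continuousAt) (fun i _ l hl => hd _ l hl) fun i _ =>
      dist_cons_lt hε (Fin.tail y) (by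
        rw [max_comm _ (t (i + 1)), max_comm _ (t i)]
        exact (abs_max_sub_max_le_abs _ _ _).trans_lt (htε i))
  have hθ1 : LZ (prismSum c M (d φ')) := fun x => locZero_prismSum_of_small
    (fun i _ => (hc i).continuousAt) (fun i _ l hl => hd _ l hl) fun i _ =>
      dist_cons_lt hε _ (htε i)
  have hψM : LZ (pull (f M) φ') := fun y => (hs.locZero hcl (by
    rw [hfmem]
    rintro ⟨h, -⟩
    have := (le_abs_self _).trans h
    have := le_max_right (y 0) (t M)
    linarith)).pull (hf M).continuousAt
  have hψ0 : LZ (φ' + pull (f 0) φ') := by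
    intro y
    by_cases hy : t 0 < y 0
    · refine ⟨_, (continuous_apply 0).continuousAt.eventually_const_lt hy, fun l hl => ?_⟩
      have : l.map (f 0) = l := by
        rw [List.map_congr_left (g := id), List.map_id]
        intro z hz
        have hz0 : t 0 < z 0 := hl z hz
        simp only [f, id, max_eq_left hz0.le, Fin.cons_self_tail]
      rw [Pi.add_apply, pull_apply, this]
      grind
    · rw [not_lt, ht0] at hy
      refine (hs.locZero hcl ?_).add ((hs.locZero hcl ?_).pull (hf 0).continuousAt)
      · rw [mem_closedBall_iff_tail hL.le]
        rintro ⟨h, -⟩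
        have := neg_le_of_abs_le h
        linarith
      · rw [hfmem, ht0, max_eq_right hy]
        rintro ⟨h, -⟩
        have := neg_le_of_abs_le h
        linarith
  have hψd : LZ (φ' + d ψ) := by
    have h := (hψ0.add hψM).add hψ1
    have h5 : φ' + d ψ = φ' + pull (f 0) φ' + pull (f M) φ' + prismSum f M (d φ') := by grind
    rwa [h5]
  have hθd : LZ (d θ) := by
    have h0 : LZ (pull (c 0) φ') := fun x => (hs.locZero hcl (by
      rw [hcmem, ht0]
      rintro ⟨h, -⟩
      have := neg_le_of_abs_le h
      linarith)).pull (hc 0).continuousAt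
    have hM : LZ (pull (c M) φ') := fun x => (hs.locZero hcl (by
      rw [hcmem]
      rintro ⟨h, -⟩
      have := (le_abs_self _).trans h
      linarith)).pull (hc M).continuousAt
    have h5 : d θ = pull (c 0) φ' + pull (c M) φ' + prismSum c M (d φ') := by grind
    rw [h5]
    exact (h0.add hM).add hθ1
  have hθcs : ∀ x ∉ Metric.closedBall (0 : Fin n → ℝ) L, LocZero θ x := fun x hx =>
    locZero_prismSum hs hcl (fun i _ => (hc i).continuousAt) fun i _ h => hx ((hcmem i x).1 h).2
  refine ⟨θ, ⟨⟨_, isCompact_closedBall _ _, subset_univ _, hθcs⟩, hφ'.deg.prismSum _ _,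
    pull_id _, hθd⟩, ?_⟩
  set Θ := pull (Fin.tail : (Fin (n + 1) → ℝ) → Fin n → ℝ) θ
  let χ : (Fin (n + 1) → ℝ) → ZMod 2 := fun y => if 0 < y 0 then 1 else 0
  have hΘcs : ∀ y : Fin (n + 1) → ℝ,
      Fin.tail y ∉ Metric.closedBall (0 : Fin n → ℝ) L → LocZero Θ y :=
    fun y hy => (hθcs _ hy).pull (continuous_tail n).continuousAt
  have hΘ0 : Θ [] = 0 := prismSum_nil _ _ _
  have hΘd : LZ (d Θ) := by rw [d_pull]; exact hθd.pull (continuous_tail n)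
  have hnull : Null univ (d (ψ + Θ + mulF χ Θ)) := by
    refine Null.of_d ?_ ⟨_, isCompact_closedBall 0 (L + 1), subset_univ _, fun y hy => ?_⟩
    · simp [hΘ0, ψ, prismSum_nil]
    · rw [mem_closedBall_iff_tail (by linarith), not_and_or, not_le] at hy
      by_cases hy' : Fin.tail y ∈ Metric.closedBall (0 : Fin n → ℝ) L
      · have hy0 := hy.resolve_right fun h => h (Metric.closedBall_subset_closedBall
          (by linarith) hy')
        rcases lt_abs.1 hy0 with h | h
        · have h1 : LocZero ψ y := locZero_prismSum hs hcl (fun i _ => (hf i).continuousAt)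
            fun i _ h' => by
              have := (le_abs_self _).trans ((hfmem i y).1 h').1
              have := le_max_left (y 0) (t i)
              linarith
          rw [add_assoc]
          refine h1.add ⟨_, (continuous_apply 0).continuousAt.eventually_const_lt
            (show (0 : ℝ) < y 0 by linarith), fun l hl => ?_⟩
          cases l with
          | nil => simp [hΘ0]
          | cons z l =>
            have hz : 0 < z 0 := hl z (by simp)
            rw [Pi.add_apply, mulF_cons, show χ z = 1 from if_pos hz]
            grind
        · refine ⟨_, (continuous_apply 0).continuousAt.eventually_lt_const
            (show y 0 < -(L + 1) by linarith), fun l hl => ?_⟩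
          have h1 : ψ l = Θ l := prismSum_congr f c Fin.tail (fun z => z 0 < -(L + 1))
            (fun i z hz => by
              simp only [f, c]
              rw [max_eq_right (hz.le.trans (htL i).1)]) M φ' l hl
          have h2 : mulF χ Θ l = 0 := by
            cases l with
            | nil => rfl
            | cons z l =>
              have hz : z 0 < -(L + 1) := hl z (by simp)
              rw [mulF_cons, show χ z = 0 from if_neg (by linarith), zero_mul]
          rw [Pi.add_apply, Pi.add_apply, h1, h2]
          grind
      · have h1 : LocZero ψ y := locZero_prismSum hs hcl (fun i _ => (hf i).continuousAt)
            fun i _ h' => hy' ((hfmem i y).1 h').2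
        exact (h1.add (hΘcs y hy')).add ((hΘcs y hy').mulF χ)
  have hlz : LZ (φ + cupd χ Θ + d (ψ + Θ + mulF χ Θ)) := by
    rw [d_add, d_add, d_mulF]
    have h5 : φ + cupd χ Θ + (d ψ + d Θ + (cupd χ Θ + mulF χ (d Θ))) =
      (φ + φ') + (φ' + d ψ) + d Θ + mulF χ (d Θ) := by grind
    rw [h5]
    exact ((hφφ'.add hψd).add hΘd).add fun y => (hΘd y).mulF χ
  exact (NullI.of_lz hlz).congr hnull

theorem null_or_of_euclidean {n k : ℕ} {φ : Cochain (Fin n → ℝ)} (hφ : Cyc id univ k φ) :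
    Null univ φ ∨ k = n + 1 ∧ Null univ (φ + pointClass n) := by
  induction n generalizing k with
  | zero => exact null_or_of_euclidean_zero hφ
  | succ n ih =>
    obtain ⟨θ, hθ, h⟩ := exists_desuspension hφ
    rcases ih hθ with h1 | ⟨hk, h1⟩
    · exact .inl (h.congr (null_cupd_tail h1))
    · refine .inr ⟨by omega, ?_⟩
      have h2 := h.add (null_cupd_tail h1)
      rw [pull_add, cupd_add, ← pointClass_succ] at h2
      convert h2 using 1
      grind

theorem not_null_pointClass (n : ℕ) : ¬ Null univ (pointClass n) := by
  induction n with
  | zero =>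
    rintro ⟨ψ, h0, -, -, h⟩
    obtain ⟨U, hU, h⟩ := h 0
    have h1 := h [0] (by simpa using mem_of_mem_nhds hU)
    rw [Pi.add_apply, d_singleton, h0, show pointClass 0 [0] = 1 from rfl] at h1
    simp at h1
  | succ n ih =>
    rintro ⟨ψ, h0, hψ, -, h⟩
    apply ih
    obtain ⟨K, hK, -, hψK⟩ := hψ.exists_cut isOpen_univ
    obtain ⟨L, hL, hKL⟩ := hK.isBounded.subset_closedBall_lt 0 0
    have hs : StrictOn (Metric.closedBall 0 L) (cut K ψ) := (strictOn_cut h0).mono hKL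
    have hcl : IsClosed (Metric.closedBall (0 : Fin (n + 1) → ℝ) L) :=
      Metric.isClosed_closedBall
    set ω := pointClass (n + 1) + d (cut K ψ)
    have hω : LZ ω := by
      have := h.add hψK.d
      rw [d_add] at this
      convert this using 1
      simp only [ω]
      grind
    obtain ⟨ε, hε, hd⟩ := exists_uniform
      (isCompact_closedBall (0 : Fin (n + 1) → ℝ) (L + 2)) fun x _ => hω x
    obtain ⟨M, t, ht0, htM, htε, htL⟩ := exists_sweep (R := L + 1) (by linarith) hε
    let c : ℕ → (Fin n → ℝ) → (Fin (n + 1) → ℝ) := fun m x => Fin.cons (t m) x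
    have hc : ∀ m, Continuous (c m) := fun m => continuous_cons_left n (t m)
    have hcmem : ∀ m x, c m x ∈ Metric.closedBall 0 L ↔
        |t m| ≤ L ∧ x ∈ Metric.closedBall 0 L :=
      fun m y => cons_mem_closedBall hL.le _ _
    have h1 : prismSum c M (pointClass (n + 1)) = pointClass n := by
      let χ : ℝ → ZMod 2 := fun a => if 0 < a then 1 else 0
      have h2 : ∀ i, prism (c i) (c (i + 1)) (pointClass (n + 1)) =
          fun l => (χ (t i) + χ (t (i + 1))) * pointClass n l := by
        intro i
        rw [pointClass_succ]
        exact prism_cupd _ _ _ _ _ _ _ (deg_pointClass n).1 (fun x => by simp [c])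
          (fun x => by simp [c, χ]) fun x => by simp [c, χ]
      have h3 : ∀ m, prismSum c m (pointClass (n + 1)) =
          fun l => (χ (t 0) + χ (t m)) * pointClass n l := by
        intro m
        induction m with
        | zero =>
          funext l
          rw [CharTwo.add_self_eq_zero, zero_mul]
          simp [prismSum]
        | succ m ih =>
          simp only [prismSum, Finset.sum_range_succ, h2] at ih ⊢
          rw [ih]
          funext l
          simp only [Pi.add_apply]
          grind
      rw [h3]
      funext l
      have h4 : χ (t 0) = 0 := if_neg (by linarith)
      have h5 : χ (t M) = 1 := if_pos (by linarith)
      rw [h4, h5]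
      ring
    have hk := d_prismSum c M (cut K ψ)
    have hcs : ∀ x ∉ Metric.closedBall (0 : Fin n → ℝ) L,
        LocZero (prismSum c M (cut K ψ)) x := fun x hx =>
      locZero_prismSum hs hcl (fun i _ => (hc i).continuousAt)
        fun i _ h => hx ((hcmem i x).1 h).2
    refine .intro (prismSum_nil c M (cut K ψ))
      ⟨_, isCompact_closedBall _ _, subset_univ _, hcs⟩ fun x => ?_
    by_cases hx : x ∈ Metric.closedBall (0 : Fin n → ℝ) L
    · have h2 : LocZero (prismSum c M ω) x := by
        refine locZero_prismSum_of_small (fun i _ => (hc i).continuousAt)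
          (fun i _ l hl => hd _ ?_ l hl) fun i _ => dist_cons_lt hε _ (htε i)
        rw [cons_mem_closedBall (by linarith), abs_le]
        have := htL i
        exact ⟨⟨by linarith, by linarith⟩,
          Metric.closedBall_subset_closedBall (by linarith) hx⟩
      have h0 : LocZero (pull (c 0) (cut K ψ)) x := (hs.locZero hcl (by
        rw [hcmem, ht0]
        rintro ⟨h, -⟩
        have := neg_le_of_abs_le h
        linarith)).pull (hc 0).continuousAt
      have hM : LocZero (pull (c M) (cut K ψ)) x := (hs.locZero hcl (by
        rw [hcmem]
        rintro ⟨h, -⟩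
        have := (le_abs_self _).trans h
        linarith)).pull (hc M).continuousAt
      have h3 := (h2.add h0).add hM
      simp only [ω] at h3
      rw [prismSum_add, h1] at h3
      convert h3 using 1
      grind
    · refine (locZero_pointClass ?_).add (hcs x hx).d
      rintro rfl
      simp [hL.le] at hx

end AlexanderSpanier

namespace AlexanderSpanier

open Set Topology

variable {X M : Type*}

open Classical in
/-- Extension by zero of a cochain along a map. -/
noncomputable def ext (j : X → M) (θ : Cochain X) : Cochain M := fun l =>
  if h : ∃ m, List.map j m = l then θ h.choose else 0

lemma pull_ext {j : X → M} (hj : Function.Injective j) (θ : Cochain X) :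
    pull j (ext j θ) = θ := by
  funext l
  rw [pull_apply]
  have h : ∃ m, List.map j m = List.map j l := ⟨l, rfl⟩
  rw [ext, dif_pos h, List.map_injective_iff.2 hj h.choose_spec]

lemma ext_nil {j : X → M} (hj : Function.Injective j) (θ : Cochain X) :
    ext j θ [] = θ [] := congrFun (pull_ext hj θ) []

lemma Deg.ext {j : X → M} (hj : Function.Injective j) {θ : Cochain X} {k : ℕ} (h : Deg k θ) :
    Deg k (ext j θ) := by
  refine ⟨(ext_nil hj θ).trans h.1, fun l hl => ?_⟩
  by_cases hm : ∃ m, List.map j m = l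
  · obtain ⟨m, rfl⟩ := hm
    rw [List.length_map] at hl
    exact (congrFun (pull_ext hj θ) m).trans (h.2 m hl)
  · exact dif_neg hm

lemma StrictOn.ext {j : X → M} (hj : Function.Injective j) {θ : Cochain X} {K : Set X}
    (h : StrictOn K θ) : StrictOn (j '' K) (ext j θ) := by
  refine ⟨(ext_nil hj θ).trans h.1, fun l y hy hyK => ?_⟩
  by_cases hm : ∃ m, List.map j m = l
  · obtain ⟨m, rfl⟩ := hm
    obtain ⟨x, hx, rfl⟩ := List.mem_map.1 hy
    exact (congrFun (pull_ext hj θ) m).trans (h.2 m x hx fun hxK => hyK ⟨x, hxK, rfl⟩)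
  · exact dif_neg hm

variable [TopologicalSpace X] [TopologicalSpace M]

lemma LocZero.of_pull {j : X → M} (hj : IsOpenEmbedding j) {φ : Cochain M} {x : X}
    (h : LocZero (AlexanderSpanier.pull j φ) x) : LocZero φ (j x) := by
  obtain ⟨U, hU, h⟩ := h
  refine ⟨j '' U, hj.image_mem_nhds.2 hU, fun l hl => ?_⟩
  obtain ⟨m, rfl⟩ : ∃ m, List.map j m = l := by
    rw [← mem_range, Set.range_list_map]
    exact fun y hy => (hl y hy).imp fun x hx => hx.2
  exact h m fun y hy => (hj.injective.mem_set_image).1 (hl _ (List.mem_map_of_mem hy))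

lemma isCompact_preimage_of_subset {j : X → M} (hj : IsOpenEmbedding j) {W K : Set M}
    (hW : W ⊆ range j) (hKW : K ⊆ W) (hK : IsCompact K) : IsCompact (j ⁻¹' K) :=
  hj.isInducing.isCompact_preimage' hK (hKW.trans hW)

lemma Cyc.pull_embedding {j : X → M} (hj : IsOpenEmbedding j) {W : Set M} (hW : W ⊆ range j)
    {k : ℕ} {φ : Cochain M} (h : Cyc id W k φ) : Cyc id (j ⁻¹' W) k (AlexanderSpanier.pull j φ) :=
  h.pull hj.continuous (fun _ => isCompact_preimage_of_subset hj hW) subset_rfl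

lemma Null.pull_embedding {j : X → M} (hj : IsOpenEmbedding j) {W : Set M} (hW : W ⊆ range j)
    {φ : Cochain M} (h : Null W φ) : Null (j ⁻¹' W) (AlexanderSpanier.pull j φ) :=
  h.pull hj.continuous (fun _ => isCompact_preimage_of_subset hj hW) subset_rfl

variable [T2Space M]

lemma locZero_ext {j : X → M} (hj : IsOpenEmbedding j) {θ : Cochain X} {K : Set X}
    (hK : IsCompact K) (h : StrictOn K θ) {z : M} (hz : z ∉ j '' K) : LocZero (ext j θ) z :=
  (h.ext hj.injective).locZero (hK.image hj.continuous).isClosed hz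

lemma Cyc.exists_ext [T2Space X] [LocallyCompactSpace X] {j : X → M}
    (hj : IsOpenEmbedding j) {W : Set X} (hW : IsOpen W) {k : ℕ} {θ : Cochain X}
    (h : Cyc id W k θ) :
    ∃ φ, Cyc id (j '' W) k φ ∧ LZ (θ + AlexanderSpanier.pull j φ) := by
  obtain ⟨K, θ', hK, hKW, hs, hθ', hlz⟩ := h.exists_strict hW
  refine ⟨AlexanderSpanier.ext j θ', ⟨⟨j '' K, hK.image hj.continuous, image_mono hKW,
    fun z hz => locZero_ext hj hK hs hz⟩, hθ'.deg.ext hj.injective, pull_id _, fun z => ?_⟩, ?_⟩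
  · by_cases hz : z ∈ j '' K
    · obtain ⟨x, -, rfl⟩ := hz
      refine .of_pull hj ?_
      rw [← d_pull, pull_ext hj.injective]
      exact hθ'.lz x
    · exact (locZero_ext hj hK hs hz).d
  · rwa [pull_ext hj.injective]

/-- Being null can be tested in a chart. -/
lemma Null.of_pull [T2Space X] [LocallyCompactSpace X] {j : X → M}
    (hj : IsOpenEmbedding j) {W : Set M} (hW : IsOpen W) (hWj : W ⊆ range j)
    {φ : Cochain M} (hφ : CS W φ)
    (h : Null (j ⁻¹' W) (AlexanderSpanier.pull j φ)) : Null W φ := by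
  obtain ⟨ψ, h0, hψ, -, hlz⟩ := h
  obtain ⟨K, hK, hKW, hψK⟩ := hψ.exists_cut (hW.preimage hj.continuous)
  have hs := strictOn_cut (A := K) h0
  refine .intro (ψ := ext j (cut K ψ)) ((ext_nil hj.injective _).trans hs.1)
    ⟨j '' K, hK.image hj.continuous, by simpa using hKW,
    fun z hz => locZero_ext hj hK hs hz⟩ fun z => ?_
  by_cases hz : z ∈ range j
  · obtain ⟨x, rfl⟩ := hz
    refine .of_pull hj ?_
    rw [pull_add, ← d_pull, pull_ext hj.injective]
    have := (hlz x).add (hψK.d x)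
    rw [d_add] at this
    convert this using 1
    grind
  · obtain ⟨C, -, hCW, hC⟩ := hφ
    exact (hC z fun h => hz (hWj (hCW h))).add
      (locZero_ext hj hK hs fun h => hz (image_subset_range _ _ h)).d

end AlexanderSpanier

namespace AlexanderSpanier

open Set Topology

variable {X M : Type*}

section Basis

variable [TopologicalSpace X] [T2Space X] [LocallyCompactSpace X]

/-- A family of open sets stable under intersection, all of whose members have no cohomology
above degree `K`, controls the cohomology of the finite unions of its members. -/
lemma null_of_list {𝓓 : Set (Set X)} (ho : ∀ B ∈ 𝓓, IsOpen B)
    (hi : ∀ A ∈ 𝓓, ∀ B ∈ 𝓓, A ∩ B ∈ 𝓓) {K : ℕ}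
    (hn : ∀ B ∈ 𝓓, ∀ k, K < k → ∀ φ, Cyc id B k φ → Null B φ) (L : List (Set X))
    (hL : ∀ B ∈ L, B ∈ 𝓓) {k : ℕ} (hk : K < k) {φ : Cochain X}
    (hφ : Cyc id (⋃ B ∈ L, B) k φ) : Null (⋃ B ∈ L, B) φ := by
  induction hm : L.length generalizing L k φ with
  | zero =>
    rw [List.length_eq_zero_iff] at hm
    subst hm
    obtain ⟨K, -, hK, h⟩ := hφ.cs
    refine NullI.of_lz fun x => h x fun hx => ?_
    simpa using hK hx
  | succ m ih =>
    obtain ⟨B, L, rfl⟩ := List.exists_cons_of_length_eq_add_one hm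
    simp only [List.length_cons, Nat.add_right_cancel_iff] at hm
    simp only [List.mem_cons, forall_eq_or_imp] at hL
    simp only [List.mem_cons, iUnion_iUnion_eq_or_left] at hφ ⊢
    rw [union_comm] at hφ ⊢
    have hLo : IsOpen (⋃ A ∈ L, A) := isOpen_biUnion fun A hA => ho A (hL.2 A hA)
    refine mayerVietoris (R := Null ((⋃ A ∈ L, A) ∪ B)) continuous_id (fun _ => rfl) hLo
      (fun _ h => h) (fun _ _ => NullI.add) (fun κ hκ => ?_)
      (fun ψ hψ => (ih L hL.2 hk hψ hm).mono subset_union_left)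
      (fun ψ hψ => (hn B hL.1 k hk ψ hψ).mono subset_union_right) (ho B hL.1) φ hφ
    have h1 : (⋃ A ∈ L, A) ∩ B = ⋃ A ∈ L.map (· ∩ B), A := by
      simp [iUnion_inter]
    rw [h1] at hκ ⊢
    refine ih _ ?_ (hk.trans (Nat.lt_succ_self k)) hκ (by simpa using hm)
    simp only [List.mem_map, forall_exists_index, and_imp, forall_apply_eq_imp_iff₂]
    exact fun A hA => hi A (hL.2 A hA) B hL.1

lemma null_of_basis {𝓓 : Set (Set X)} (ho : ∀ B ∈ 𝓓, IsOpen B)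
    (hi : ∀ A ∈ 𝓓, ∀ B ∈ 𝓓, A ∩ B ∈ 𝓓) {K : ℕ}
    (hn : ∀ B ∈ 𝓓, ∀ k, K < k → ∀ φ, Cyc id B k φ → Null B φ) {W : Set X}
    (hW : ∀ x ∈ W, ∃ B ∈ 𝓓, x ∈ B ∧ B ⊆ W) {k : ℕ} (hk : K < k) {φ : Cochain X}
    (hφ : Cyc id W k φ) : Null W φ := by
  obtain ⟨C, hC, hCW, h⟩ := hφ.cs
  choose! B hB hxB hBW using hW
  obtain ⟨t, ht⟩ := hC.elim_nhds_subcover' (fun x _ => B x) fun x hx =>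
    (ho _ (hB x (hCW hx))).mem_nhds (hxB x (hCW hx))
  have hφ' : Cyc id (⋃ A ∈ t.toList.map fun x : C => B x, A) k φ := by
    refine ⟨⟨C, hC, ?_, h⟩, hφ.deg, hφ.inv, hφ.lz⟩
    simpa using ht
  refine (null_of_list ho hi hn _ ?_ hk hφ').mono ?_
  · rintro A hA
    obtain ⟨x, -, rfl⟩ := List.mem_map.1 hA
    exact hB x (hCW x.2)
  · refine iUnion₂_subset fun A hA => ?_
    obtain ⟨x, -, rfl⟩ := List.mem_map.1 hA
    exact hBW x (hCW x.2)

end Basis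

section Charts

variable [TopologicalSpace M]

/-- `V` is an open subset homeomorphic to `ℝⁿ`. -/
def IsChart (n : ℕ) (V : Set M) : Prop :=
  ∃ j : (Fin n → ℝ) → M, IsOpenEmbedding j ∧ range j = V

lemma IsChart.isOpen {n : ℕ} {V : Set M} (hV : IsChart n V) : IsOpen V := by
  obtain ⟨j, hj, rfl⟩ := hV
  exact hj.isOpen_range

variable [T2Space M] {n k : ℕ} {V : Set M} {φ ψ : Cochain M}

lemma IsChart.null_of_ne (hV : IsChart n V) (hk : k ≠ n + 1) (hφ : Cyc id V k φ) :
    Null V φ := by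
  obtain ⟨j, hj, rfl⟩ := hV
  refine Null.of_pull hj hj.isOpen_range subset_rfl hφ.cs ?_
  have h := hφ.pull_embedding hj subset_rfl
  rw [preimage_range] at h ⊢
  exact (null_or_of_euclidean h).resolve_right fun h => hk h.1

lemma IsChart.null_or (hV : IsChart n V) (hφ : Cyc id V k φ) (hψ : Cyc id V k ψ) :
    Null V φ ∨ Null V ψ ∨ Null V (φ + ψ) := by
  obtain ⟨j, hj, rfl⟩ := hV
  have h1 := hφ.pull_embedding hj subset_rfl
  have h2 := hψ.pull_embedding hj subset_rfl
  rw [preimage_range] at h1 h2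
  rcases null_or_of_euclidean h1 with h1 | ⟨-, h1⟩
  · exact .inl (.of_pull hj hj.isOpen_range subset_rfl hφ.cs (by rwa [preimage_range]))
  rcases null_or_of_euclidean h2 with h2 | ⟨-, h2⟩
  · exact .inr (.inl (.of_pull hj hj.isOpen_range subset_rfl hψ.cs (by rwa [preimage_range])))
  · refine .inr (.inr (.of_pull hj hj.isOpen_range subset_rfl (hφ.add hψ).cs ?_))
    rw [preimage_range]
    convert h1.add h2 using 1
    rw [pull_add]
    grind

lemma cyc_pointClass_sub {W : Set (Fin n → ℝ)} {x : Fin n → ℝ} (hx : x ∈ W) :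
    Cyc id W (n + 1) (pull (fun y => y - x) (pointClass n)) := by
  refine (cyc_pointClass n (W := {0}) rfl).pull (by fun_prop) (fun K hK _ => ?_) ?_
  · refine isCompact_singleton (x := x) |>.of_isClosed_subset ?_ ?_
    · rcases subset_singleton_iff_eq.1 hK with rfl | rfl
      · simp
      · exact isClosed_singleton.preimage (by fun_prop)
    · exact fun y hy => by simpa [sub_eq_zero] using hK hy
  · intro y hy
    rw [mem_preimage, mem_singleton_iff, sub_eq_zero] at hy
    rwa [hy]

lemma not_null_pointClass_sub (x : Fin n → ℝ) :
    ¬ Null univ (pull (fun y => y - x) (pointClass n)) := by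
  intro h
  have := h.pull (V := univ) (f := fun y => y + x) (by fun_prop)
    (fun K _ hK => (Homeomorph.addRight x).isCompact_preimage.2 hK) (subset_univ _)
  rw [pull_pull] at this
  refine not_null_pointClass n ?_
  convert this using 1
  rw [show (fun y => y - x) ∘ (fun y => y + x) = id by ext; simp, pull_id]

lemma IsChart.exists_class (hV : IsChart n V) {z : M} (hz : z ∈ V) {O : Set M} (hO : IsOpen O)
    (hzO : z ∈ O) : ∃ e, Cyc id (O ∩ V) (n + 1) e ∧ ¬ Null V e := by
  obtain ⟨j, hj, rfl⟩ := hV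
  obtain ⟨x, rfl⟩ := hz
  obtain ⟨e, he, hlz⟩ := Cyc.exists_ext hj (hO.preimage hj.continuous)
    (cyc_pointClass_sub (n := n) (x := x) hzO)
  rw [image_preimage_eq_inter_range] at he
  refine ⟨e, he, fun h => not_null_pointClass_sub x ?_⟩
  have h := h.pull_embedding hj subset_rfl
  rw [preimage_range] at h
  exact (NullI.of_lz hlz).congr h

end Charts

end AlexanderSpanier

namespace AlexanderSpanier

open Set Topology

lemma exists_isOpenEmbedding_range_eq_Ioo {a b : ℝ} (h : a < b) :
    ∃ e : ℝ → ℝ, IsOpenEmbedding e ∧ range e = Ioo a b := by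
  let e := OpenPartialHomeomorph.univBall ((a + b) / 2) ((b - a) / 2)
  refine ⟨e, e.isOpenEmbedding (OpenPartialHomeomorph.univBall_source _ _), ?_⟩
  rw [← image_univ, ← OpenPartialHomeomorph.univBall_source ((a + b) / 2) ((b - a) / 2),
    e.image_source_eq_target, OpenPartialHomeomorph.univBall_target _ (by linarith),
    Real.ball_eq_Ioo]
  congr 1 <;> ring

lemma isChart_box {n : ℕ} {a b : Fin n → ℝ} (h : ∀ i, a i < b i) :
    IsChart n (Set.pi univ fun i => Ioo (a i) (b i)) := by
  choose e he hr using fun i => exists_isOpenEmbedding_range_eq_Ioo (h i)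
  refine ⟨Pi.map e, .piMap he, ?_⟩
  rw [range_piMap]
  simp_rw [hr]

lemma null_of_lt_euclidean {n k : ℕ} {W : Set (Fin n → ℝ)} (hW : IsOpen W) (hk : n + 1 < k)
    {φ : Cochain (Fin n → ℝ)} (hφ : Cyc id W k φ) : Null W φ := by
  refine null_of_basis (𝓓 := {S | ∃ a b : Fin n → ℝ, S = Set.pi univ fun i => Ioo (a i) (b i)})
    ?_ ?_ (K := n + 1) ?_ ?_ hk hφ
  · rintro _ ⟨a, b, rfl⟩
    exact isOpen_set_pi finite_univ fun _ _ => isOpen_Ioo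
  · rintro _ ⟨a, b, rfl⟩ _ ⟨a', b', rfl⟩
    refine ⟨a ⊔ a', b ⊓ b', ?_⟩
    rw [← pi_inter_distrib]
    simp [Ioo_inter_Ioo]
  · rintro _ ⟨a, b, rfl⟩ k hk φ hφ
    by_cases h : ∀ i, a i < b i
    · exact (isChart_box h).null_of_ne hk.ne' hφ
    · push Not at h
      obtain ⟨i, hi⟩ := h
      obtain ⟨K, -, hK, h⟩ := hφ.cs
      refine NullI.of_lz fun x => h x fun hx => ?_
      have := hK hx i trivial
      exact (this.1.trans this.2).not_ge hi
  · intro x hx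
    obtain ⟨ε, hε, h⟩ := Metric.isOpen_iff.1 hW x hx
    refine ⟨_, ⟨fun i => x i - ε, fun i => x i + ε, rfl⟩, fun i _ => ⟨by linarith, by linarith⟩,
      ?_⟩
    simp_rw [← Real.ball_eq_Ioo]
    rwa [← ball_pi _ hε]

variable {M : Type*} [TopologicalSpace M] [T2Space M] {n k : ℕ} {V W : Set M} {φ : Cochain M}

lemma IsChart.null_of_lt (hV : IsChart n V) (hW : IsOpen W) (hWV : W ⊆ V) (hk : n + 1 < k)
    (hφ : Cyc id W k φ) : Null W φ := by
  obtain ⟨j, hj, rfl⟩ := hV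
  exact Null.of_pull hj hW hWV hφ.cs <|
    null_of_lt_euclidean (hW.preimage hj.continuous) hk (hφ.pull_embedding hj hWV)

/-- Every point of `M` has arbitrarily small neighbourhoods homeomorphic to `ℝⁿ`. -/
def HasCharts (n : ℕ) (M : Type*) [TopologicalSpace M] : Prop :=
  ∀ z : M, ∀ U ∈ 𝓝 z, ∃ V, IsChart n V ∧ z ∈ V ∧ V ⊆ U

/-- A chart is good if its generator survives in the cohomology of `M`. -/
def Good (n : ℕ) (V : Set M) : Prop :=
  ∀ φ, Cyc id V (n + 1) φ → Null univ φ → Null V φ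

lemma IsChart.good_of_exists (hV : IsChart n V) {e : Cochain M} (he : Cyc id V (n + 1) e)
    (h : ¬ Null univ e) : Good n V := by
  intro φ hφ hn
  rcases hV.null_or hφ he with h1 | h1 | h1
  · exact h1
  · exact (h (h1.mono (subset_univ _))).elim
  · exact (h (Null.congr_right (h1.mono (subset_univ _)) hn)).elim

lemma Good.of_inter (hG : Good n V) (hV : IsChart n V)
    (hW : IsChart n W) (h : (V ∩ W).Nonempty) : Good n W := by
  obtain ⟨z, hzV, hzW⟩ := h
  obtain ⟨e, he, hne⟩ := hV.exists_class hzV hW.isOpen hzW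
  exact hW.good_of_exists (he.mono inter_subset_left)
    fun h => hne (hG e (he.mono inter_subset_right) h)

lemma HasCharts.exists_good [LocallyCompactSpace M] (hM : HasCharts n M) {φ : Cochain M}
    (hφ : Cyc id univ (n + 1) φ) (h : ¬ Null univ φ) :
    ∃ V : Set M, IsChart n V ∧ Good n V := by
  by_contra! hG
  refine h (cover_induction (R := Null univ) continuous_id (fun _ => rfl) {V | IsChart n V}
    (fun V hV => hV.isOpen) (fun _ _ _ h => h) (fun x => ?_) (fun _ => NullI.of_lz)
    (fun _ _ => NullI.add) (fun V hV A hA _ κ hκ => ?_) (fun V hV ψ hψ => ?_) φ hφ)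
  · obtain ⟨V, hV, hx, -⟩ := hM x univ Filter.univ_mem
    exact ⟨V, hV, hx⟩
  · exact IsChart.null_of_lt hV (hA.inter hV.isOpen) inter_subset_right (by omega) hκ
  · by_contra hn
    exact hG V hV (IsChart.good_of_exists hV hψ hn)

end AlexanderSpanier

namespace AlexanderSpanier

open Set Topology

variable {M : Type*} [TopologicalSpace M] {τ : M → M} {n k : ℕ} {A V : Set M} {φ ψ : Cochain M}

lemma isCompact_preimage_involutive (hτ : Continuous τ) (hττ : Function.Involutive τ) {K : Set M}
    (hK : IsCompact K) : IsCompact (τ ⁻¹' K) := by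
  rw [← Set.image_eq_preimage_of_inverse hττ hττ]
  exact hK.image hτ

lemma CS.pull_involutive (h : CS V φ) (hτ : Continuous τ) (hττ : Function.Involutive τ) :
    CS (τ ⁻¹' V) (AlexanderSpanier.pull τ φ) :=
  h.pull hτ (fun _ _ => isCompact_preimage_involutive hτ hττ) subset_rfl

lemma Null.pull_involutive (h : Null V φ) (hτ : Continuous τ) (hττ : Function.Involutive τ) :
    Null (τ ⁻¹' V) (AlexanderSpanier.pull τ φ) :=
  h.pull hτ (fun _ _ => isCompact_preimage_involutive hτ hττ) subset_rfl

lemma Cyc.pull_involutive (h : Cyc id V k φ) (hτ : Continuous τ) (hττ : Function.Involutive τ) :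
    Cyc id (τ ⁻¹' V) k (AlexanderSpanier.pull τ φ) :=
  h.pull hτ (fun _ _ => isCompact_preimage_involutive hτ hττ) subset_rfl

lemma pull_pull_involutive {X : Type*} {τ : X → X} (hττ : Function.Involutive τ) (φ : Cochain X) :
    pull τ (pull τ φ) = φ := by
  rw [pull_pull, hττ.comp_self, pull_id]

/-- A cocycle invariant under an involution and supported in the disjoint union of `V` and its
mirror image is the norm of a cocycle supported in `V`. -/
lemma Cyc.exists_split (hτ : Continuous τ) (hττ : Function.Involutive τ) (hV : IsOpen V)
    (hVτ : Disjoint V (τ ⁻¹' V)) (h : Cyc τ (A ∩ (V ∪ τ ⁻¹' V)) k φ) :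
    ∃ ψ, Cyc id (A ∩ V) k ψ ∧ LZ (φ + (ψ + AlexanderSpanier.pull τ ψ)) := by
  obtain ⟨K, hK, hKA, hφK⟩ := h.cs
  have hcl : ∀ x ∈ τ ⁻¹' V, x ∉ closure V := fun x hx hxV =>
    (hVτ.closure_left (hV.preimage hτ)).le_bot ⟨hxV, hx⟩
  have hfar : ∀ x ∈ τ ⁻¹' V, LocZero (AlexanderSpanier.cut V φ) x :=
    fun x hx => locZero_cut h.deg.1 (hcl x hx)
  have hinv : ∀ x, LocZero φ x → LocZero φ (τ x) := fun x hx => by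
    rw [← h.inv]
    exact LocZero.pull (by rwa [hττ x]) hτ.continuousAt
  have hcs : ∀ x ∉ K \ τ ⁻¹' V, LocZero (AlexanderSpanier.cut V φ) x := fun x hx => by
    by_cases hxK : x ∈ K
    · exact hfar x (by_contra fun h => hx ⟨hxK, h⟩)
    · exact (hφK x hxK).cut
  have hsub : K \ τ ⁻¹' V ⊆ A ∩ V := fun x hx =>
    ⟨(hKA hx.1).1, (hKA hx.1).2.resolve_right hx.2⟩
  refine ⟨AlexanderSpanier.cut V φ, ⟨⟨_, hK.diff (hV.preimage hτ), hsub, hcs⟩, h.deg.cut V,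
    pull_id _, fun x => ?_⟩, fun x => ?_⟩
  · by_cases hx : x ∈ V
    · have := (locZero_add_cut (φ := φ) (hV.mem_nhds hx)).d.add (h.lz x)
      rw [d_add] at this
      convert this using 1
      grind
    · exact (hcs x fun hx' => hx (hsub hx').2).d
  · by_cases hx : x ∈ V
    · rw [← add_assoc]
      refine (locZero_add_cut (hV.mem_nhds hx)).add ((hfar _ ?_).pull hτ.continuousAt)
      rwa [mem_preimage, hττ x]
    by_cases hx' : x ∈ τ ⁻¹' V
    · have h1 := (locZero_add_cut (φ := φ) (hV.mem_nhds hx')).pull hτ.continuousAt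
      rw [pull_add, h.inv] at h1
      convert h1.add (hfar x hx') using 1
      grind
    · have h1 : LocZero φ x := hφK x fun hxK => (hKA hxK).2.elim hx hx'
      exact h1.add (h1.cut.add ((hinv x h1).cut.pull hτ.continuousAt))

/-- On a manifold with a free involution, top-dimensional invariant cocycles are null as soon as
norms are. -/
lemma HasCharts.null_of_free [T2Space M] [LocallyCompactSpace M] (hM : HasCharts n M)
    (hτ : Continuous τ) (hττ : Function.Involutive τ) (hfree : ∀ x, τ x ≠ x)
    (hnorm : ∀ e, Cyc id univ (n + 1) e → Null univ (e + pull τ e))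
    (hφ : Cyc τ univ (n + 1) φ) : Null univ φ := by
  refine cover_induction (R := Null univ) hτ hττ
    {B | ∃ V, IsChart n V ∧ Disjoint V (τ ⁻¹' V) ∧ B = V ∪ τ ⁻¹' V} ?_ ?_ (fun x => ?_)
    (fun _ => NullI.of_lz) (fun _ _ => NullI.add) ?_ ?_ φ hφ
  · rintro _ ⟨V, hV, -, rfl⟩
    exact hV.isOpen.union (hV.isOpen.preimage hτ)
  · rintro _ ⟨V, -, -, rfl⟩ x (hx | hx)
    · exact .inr (by rwa [mem_preimage, hττ x])
    · exact .inl hx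
  · obtain ⟨U, U', hU, hU', hx, hx', hUU'⟩ := t2_separation (hfree x).symm
    obtain ⟨V, hV, hxV, hVU⟩ := hM x (U ∩ τ ⁻¹' U')
      ((hU.inter (hU'.preimage hτ)).mem_nhds ⟨hx, hx'⟩)
    refine ⟨_, ⟨V, hV, ?_, rfl⟩, .inl hxV⟩
    rw [Set.disjoint_left] at hUU' ⊢
    exact fun y hy hy' => hUU' (hVU hy').1 (hVU hy).2
  · rintro _ ⟨V, hV, hVτ, rfl⟩ A hA hAτ κ hκ
    obtain ⟨κ', hκ', hlz⟩ := hκ.exists_split hτ hττ hV.isOpen hVτ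
    obtain ⟨ψ, h0, hψ, -, h1⟩ :=
      hV.null_of_lt (hA.inter hV.isOpen) inter_subset_right (by omega) hκ'
    refine ⟨ψ + pull τ ψ, ?_, ?_, ?_, ?_⟩
    · simp [h0]
    · refine (hψ.mono ?_).add ((hψ.pull_involutive hτ hττ).mono ?_)
      · exact inter_subset_inter_right _ subset_union_left
      · rintro x ⟨hx, hx'⟩
        exact ⟨hττ x ▸ hAτ _ hx, .inr hx'⟩
    · rw [pull_add, pull_pull_involutive hττ, add_comm]
    · convert (hlz.add h1).add (h1.pull hτ) using 1
      rw [pull_add, d_add, ← d_pull]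
      grind
  · rintro _ ⟨V, hV, hVτ, rfl⟩ ψ hψ
    rw [← univ_inter (V ∪ τ ⁻¹' V)] at hψ
    obtain ⟨ψ', hψ', hlz⟩ := hψ.exists_split hτ hττ hV.isOpen hVτ
    exact (NullI.of_lz hlz).congr (hnorm ψ' (hψ'.mono (subset_univ _)))

end AlexanderSpanier

namespace AlexanderSpanier

open Set Topology

section Tower

variable {X : Type*}

/-- The transfer tower over `cupF n s` for an involution `τ` with `s k ∘ τ = s k + 1 + δ`, where
`δ` is the indicator of the fixed point set. -/
def tower (τ : X → X) (δ : X → ZMod 2) : (n : ℕ) → (Fin n → X → ZMod 2) → ℕ → Cochain X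
  | 0, _, 0 => one
  | 0, _, _ + 1 => 0
  | n + 1, s, 0 => cupd (s 0) (tower τ δ n (Fin.tail s) 0)
  | n + 1, s, j + 1 => cupd (s 0) (tower τ δ n (Fin.tail s) (j + 1)) +
      mulF δ (pull τ (tower τ δ n (Fin.tail s) j))

variable (τ : X → X) (δ : X → ZMod 2)

lemma tower_zero (n : ℕ) (s : Fin n → X → ZMod 2) : tower τ δ n s 0 = cupF n s := by
  induction n with
  | zero => rfl
  | succ n ih => rw [tower, cupF, ih]

lemma tower_eq_zero (n : ℕ) (s : Fin n → X → ZMod 2) {j : ℕ} (hj : n < j) :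
    tower τ δ n s j = 0 := by
  induction n generalizing j with
  | zero =>
    obtain ⟨j, rfl⟩ := Nat.exists_eq_succ_of_ne_zero hj.ne'
    rfl
  | succ n ih =>
    obtain ⟨j, rfl⟩ := Nat.exists_eq_succ_of_ne_zero (n.succ_pos.trans hj).ne'
    rw [tower, ih _ (by omega), ih _ (by omega), cupd_zero, pull_zero]
    funext l
    cases l <;> simp [mulF_cons]

lemma deg_tower (n : ℕ) (s : Fin n → X → ZMod 2) {j k : ℕ} (hj : k + j = n + 1) :
    Deg k (tower τ δ n s j) := by
  induction n generalizing j k with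
  | zero =>
    cases j with
    | zero =>
      obtain rfl : k = 1 := by omega
      exact deg_one
    | succ j => exact deg_zero _
  | succ n ih =>
    cases j with
    | zero =>
      obtain rfl : k = n + 1 + 1 := by omega
      exact (ih _ (by omega)).cupd _
    | succ j =>
      refine Deg.add ?_ (((ih _ (by omega)).pull τ).mulF δ)
      cases k with
      | zero =>
        rw [tower_eq_zero _ _ _ _ (by omega), cupd_zero]
        exact deg_zero _
      | succ k => exact (ih _ (by omega)).cupd _

lemma tower_nil (n : ℕ) (s : Fin n → X → ZMod 2) (j : ℕ) : tower τ δ n s j [] = 0 := by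
  rcases lt_or_ge n j with h | h
  · rw [tower_eq_zero τ δ n s h]; rfl
  · exact (deg_tower τ δ n s (j := j) (k := n + 1 - j) (by omega)).1

lemma tower_apply_singleton (n : ℕ) (s : Fin n → X → ZMod 2) {q : X} (hq : τ q = q)
    (hδ : δ q = 1) : tower τ δ n s n [q] = 1 := by
  induction n with
  | zero => rfl
  | succ n ih =>
    rw [tower, tower_eq_zero _ _ _ _ (Nat.lt_succ_self n), cupd_zero, zero_add, mulF_cons,
      pull_apply, hδ, one_mul]
    simpa [hq] using ih (Fin.tail s)

lemma cupd_comp (χ : X → ZMod 2) (hχ : ∀ x, χ (τ x) = χ x + 1 + δ x) {φ : Cochain X}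
    (hφ : φ [] = 0) : cupd (χ ∘ τ) φ = cupd χ φ + cupd δ φ := by
  funext l
  rcases l with _ | ⟨x, _ | ⟨y, l⟩⟩
  · rfl
  · simp [cupd_cons, hφ]
  · simp only [cupd_cons, mulF_cons, Pi.add_apply, Function.comp_apply, hχ]
    grind

lemma d_tower {τ : X → X} {δ : X → ZMod 2} (hττ : Function.Involutive τ) (hδ : δ ∘ τ = δ)
    (n : ℕ) (s : Fin n → X → ZMod 2)
    (hs : ∀ k x, s k (τ x) = s k x + 1 + δ x) (j : ℕ) :
    d (tower τ δ n s (j + 1)) = tower τ δ n s j + pull τ (tower τ δ n s j) := by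
  induction n generalizing j with
  | zero =>
    cases j with
    | zero =>
      simp only [tower, d_zero, pull_one]
      grind
    | succ j => simp [tower, d_zero, pull_zero]
  | succ n ih =>
    have hs' : ∀ k x, Fin.tail s k (τ x) = Fin.tail s k x + 1 + δ x := fun k => hs k.succ
    have h1 : ∀ i, cupd (s 0 ∘ τ) (pull τ (tower τ δ n (Fin.tail s) i)) =
        cupd (s 0) (pull τ (tower τ δ n (Fin.tail s) i)) +
          cupd δ (pull τ (tower τ δ n (Fin.tail s) i)) := fun i =>
      cupd_comp τ δ _ (hs 0) (tower_nil τ δ n _ i)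
    cases j with
    | zero =>
      have h0 : d (tower τ δ n (Fin.tail s) 0) = 0 := by rw [tower_zero, d_cupF]
      simp only [tower, d_add, d_cupd, d_mulF, pull_cupd, h1, d_pull, ih _ hs', h0, pull_zero,
        cupd_add]
      have h2 : mulF δ (0 : Cochain X) = 0 := by funext l; cases l <;> simp [mulF_cons]
      rw [h2]
      grind
    | succ j =>
      simp only [tower, d_add, d_cupd, d_mulF, pull_cupd, pull_mulF, pull_add, h1, d_pull,
        ih _ hs', cupd_add, mulF_add, hδ, pull_pull_involutive hττ]
      grind

end Tower

variable {M : Type*} [TopologicalSpace M]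

lemma locZero_mulF_of_eventually {χ : M → ZMod 2} {x : M} (h : ∀ᶠ y in 𝓝 x, χ y = 0)
    (φ : Cochain M) : LocZero (mulF χ φ) x := by
  refine ⟨_, h, fun l hl => ?_⟩
  cases l with
  | nil => rfl
  | cons y l =>
    have hy : χ y = 0 := hl y (by simp)
    rw [mulF_cons, hy, zero_mul]

lemma locZero_tower (τ : M → M) (δ : M → ZMod 2) (n : ℕ) (s : Fin n → M → ZMod 2) {x : M}
    (k : Fin n) (hk : ∀ᶠ y in 𝓝 x, s k y = s k x) (hδ : ∀ᶠ y in 𝓝 x, δ y = 0) (j : ℕ) :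
    LocZero (tower τ δ n s j) x := by
  induction n generalizing j with
  | zero => exact k.elim0
  | succ n ih =>
    have h : ∀ i, LocZero (cupd (s 0) (tower τ δ n (Fin.tail s) i)) x := fun i => by
      induction k using Fin.cases with
      | zero => exact locZero_cupd_of_const (tower_nil τ δ n _ i) hk
      | succ k => exact (ih (Fin.tail s) k hk i).cupd _
    cases j with
    | zero => exact h 0
    | succ j => exact (h _).add (locZero_mulF_of_eventually hδ _)

lemma exists_cupF_add_cupF (n : ℕ) (s s' : Fin n → M → ZMod 2) :
    ∃ E : Cochain M, E [] = 0 ∧ cupF n s + cupF n s' = d E ∧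
      ∀ x, (∃ k, ∀ᶠ y in 𝓝 x, s k y = s k x ∧ s' k y = s k y) → LocZero E x := by
  induction n with
  | zero =>
    refine ⟨0, rfl, ?_, fun x h => locZero_zero x⟩
    rw [d_zero, cupF, cupF]
    grind
  | succ n ih =>
    obtain ⟨E, h0, hE, h⟩ := ih (Fin.tail s) (Fin.tail s')
    refine ⟨mulF (s 0 + s' 0) (cupF n (Fin.tail s)) + cupd (s' 0) E, by simp, ?_, ?_⟩
    · rw [d_add, d_mulF, d_cupF, d_cupd, ← hE, cupd_add, cupF, cupF]
      have h1 : mulF (s 0 + s' 0) (0 : Cochain M) = 0 := by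
        funext l; cases l <;> simp [mulF_cons]
      have h2 : cupd (s 0 + s' 0) (cupF n (Fin.tail s)) =
          cupd (s 0) (cupF n (Fin.tail s)) + cupd (s' 0) (cupF n (Fin.tail s)) := by
        funext l
        rcases l with _ | ⟨x, _ | ⟨y, l⟩⟩
        · rfl
        · simp [cupd_cons, (deg_cupF n (Fin.tail s)).1]
        · simp only [cupd_cons, mulF_cons, Pi.add_apply]
          ring
      rw [h1, h2]
      grind
    · rintro x ⟨k, hk⟩
      induction k using Fin.cases with
      | zero =>
        refine LocZero.add (locZero_mulF_of_eventually (hk.mono fun y hy => ?_) _)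
          (locZero_cupd_of_const h0 (hk.mono fun y hy => ?_))
        · rw [Pi.add_apply, hy.2]
          grind
        · rw [hy.2, hy.1, hk.self_of_nhds.2]
      | succ k =>
        refine LocZero.add ((locZero_cupF k (hk.mono fun y hy => hy.1)).mulF _)
          ((h x ⟨k, hk⟩).cupd _)

end AlexanderSpanier

namespace AlexanderSpanier

open Set Topology

lemma tower_succ_eq_zero {X : Type*} (τ : X → X) (n : ℕ) (s : Fin n → X → ZMod 2) (j : ℕ) :
    tower τ 0 n s (j + 1) = 0 := by
  have h (φ : Cochain X) : mulF 0 φ = 0 := by funext l; cases l <;> simp [mulF_cons]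
  induction n generalizing j with
  | zero => rfl
  | succ n ih => rw [tower, ih, cupd_zero, h, add_zero]

/-- A choice of signs for the coordinates of an odd map which is as odd as possible. -/
lemma exists_signs {X : Type*} {τ : X → X} (hττ : Function.Involutive τ) {n : ℕ}
    {F : X → Fin n → ℝ} (hF : ∀ x, F (τ x) = -F x) {δ : X → ZMod 2}
    (hδ : ∀ x, τ x = x → δ x = 1) (hδ' : ∀ x, τ x ≠ x → δ x = 0) :
    ∃ s : Fin n → X → ZMod 2, (∀ k x, s k (τ x) = s k x + 1 + δ x) ∧
      ∀ k x, F x k ≠ 0 → s k x = if 0 < F x k then 1 else 0 := by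
  classical
  let r : X → X → Prop := WellOrderingRel
  let ε : X → ZMod 2 := fun x => if r x (τ x) then 1 else 0
  refine ⟨fun k x => if F x k ≠ 0 then if 0 < F x k then 1 else 0 else ε x, fun k x => ?_,
    fun k x hx => if_pos hx⟩
  simp only [hF, Pi.neg_apply, ne_eq, neg_eq_zero]
  by_cases hx : F x k = 0
  · simp only [hx, not_true_eq_false, if_false, ε, hττ x]
    by_cases hx' : τ x = x
    · rw [hx', hδ x hx', if_neg (irrefl_of r x)]
      decide
    · rw [hδ' x hx']
      rcases trichotomous_of r x (τ x) with h | h | h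
      · rw [if_pos h, if_neg (asymm_of r h)]
        decide
      · exact (hx' h.symm).elim
      · rw [if_pos h, if_neg (asymm_of r h)]
        decide
  · have hx' : τ x ≠ x := fun h => hx <| by
      have := congrFun (hF x) k
      rw [h, Pi.neg_apply] at this
      linarith
    rw [if_pos hx, if_pos hx, hδ' x hx']
    rcases lt_or_gt_of_ne hx with h | h
    · rw [if_pos (by linarith), if_neg h.not_gt]
      decide
    · rw [if_neg (by linarith), if_pos h]
      decide

variable {M : Type*} [TopologicalSpace M] [T2Space M] {n : ℕ} {τ : M → M}

/-- If two distinct points were fixed, then walking up the tower would separate them. -/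
lemma exists_localized (hM : HasCharts n M) (hτ : Continuous τ) (hττ : Function.Involutive τ)
    (hvan : ∀ k < n + 1, ∀ φ : Cochain M, Cyc id univ k φ → Null univ φ)
    (hgood : ∀ V : Set M, IsChart n V → Good n V) {b : ℕ → Cochain M}
    (hbdeg : ∀ j k, k + j = n + 1 → Deg k (b j)) (hbcs : ∀ j, CS univ (b j))
    (hbd : ∀ j, d (b (j + 1)) = b j + pull τ (b j))
    (hb0 : ∀ e, Cyc id univ (n + 1) e → ¬ Null univ e → Null univ (e + b 0))
    {p : M} (hp : τ p = p) (j k : ℕ) (hk : k + j = n + 1) (O : Set M) (hO : IsOpen O)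
    (hpO : p ∈ O) : ∃ β a c, CS O β ∧ Deg k β ∧ CS univ c ∧ Deg (k - 1) c ∧
      LZ (β + b j + (a + pull τ a) + d c) := by
  induction j generalizing k O with
  | zero =>
    obtain rfl : k = n + 1 := by omega
    obtain ⟨V, hV, hpV, -⟩ := hM p univ Filter.univ_mem
    obtain ⟨e, he, hne⟩ := hV.exists_class hpV hO hpO
    have he' : ¬ Null univ e := fun h => hne (hgood V hV e (he.mono inter_subset_right) h)
    obtain ⟨c, hc, hccs, -, hlz⟩ := (hb0 e (he.mono (subset_univ _)) he').exists_deg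
      (he.deg.add (hbdeg 0 (n + 1) rfl))
    refine ⟨e, 0, c, he.cs.mono inter_subset_left, he.deg, hccs, hc, ?_⟩
    rwa [pull_zero, add_zero, add_zero]
  | succ j ih =>
    obtain ⟨V, hV, hpV, hVO⟩ := hM p O (hO.mem_nhds hpO)
    obtain ⟨β, a, c, hβ, hβk, hc, hck, hlz⟩ := ih (k + 1) (by omega) (V ∩ τ ⁻¹' V)
      (hV.isOpen.inter (hV.isOpen.preimage hτ)) ⟨hpV, by rwa [mem_preimage, hp]⟩
    rw [Nat.add_sub_cancel] at hck
    set η := b (j + 1) + (c + pull τ c) with hη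
    have hηcs : CS univ η := (hbcs _).add (hc.add ((hc.pull_involutive hτ hττ).mono
      (subset_univ _)))
    have hηk : Deg k η := (hbdeg _ _ hk).add (hck.add (hck.pull τ))
    have h1 : LZ (β + pull τ β + d η) := by
      have h2 := hlz.add (hlz.pull hτ)
      simp only [pull_add, pull_pull_involutive hττ, ← d_pull] at h2
      rw [hη, d_add, d_add, hbd]
      convert h2 using 1
      grind
    have hβV : Cyc id V (k + 1) (β + pull τ β) := by
      refine ⟨(hβ.mono inter_subset_left).add ((hβ.pull_involutive hτ hττ).mono fun x hx => ?_),
        hβk.add (hβk.pull τ), pull_id _, ?_⟩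
      · rw [mem_preimage, mem_inter_iff, mem_preimage, hττ x] at hx
        exact hx.2
      · have := h1.d
        rwa [d_add, d_d, add_zero] at this
    have hnull : Null V (β + pull τ β) := by
      by_cases hkn : k = n
      · subst hkn
        exact hgood V hV _ hβV (.intro hηk.1 hηcs h1)
      · exact hV.null_of_ne (by omega) hβV
    obtain ⟨β', hβ'k, hβ', -, hβ'lz⟩ := hnull.exists_deg hβV.deg
    rw [Nat.add_sub_cancel] at hβ'k
    have hζ : Cyc id univ k (β' + η) := by
      refine ⟨(hβ'.mono (subset_univ _)).add hηcs, hβ'k.add hηk, pull_id _, ?_⟩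
      rw [d_add]
      convert h1.add hβ'lz using 1
      grind
    obtain ⟨c', hc'k, hc', -, hc'lz⟩ := (hvan k (by omega) _ hζ).exists_deg hζ.deg
    refine ⟨β', c, c', hβ'.mono hVO, hβ'k, hc', hc'k, ?_⟩
    rwa [hη, ← add_assoc] at hc'lz

/-- An involution on an `n`-manifold with the compactly supported cohomology of `ℝⁿ` which admits
an odd proper map of degree one to `ℝⁿ` has exactly one fixed point. -/
theorem existsUnique_fixed [LocallyCompactSpace M] (hM : HasCharts n M) (hτ : Continuous τ)
    (hττ : Function.Involutive τ) {F : M → Fin n → ℝ} (hF : Continuous F)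
    (hFτ : ∀ x, F (τ x) = -F x) (hFc : IsCompact (F ⁻¹' {0}))
    (hvan : ∀ k < n + 1, ∀ φ : Cochain M, Cyc id univ k φ → Null univ φ)
    (htop : ∀ φ ψ : Cochain M, Cyc id univ (n + 1) φ → Cyc id univ (n + 1) ψ →
      Null univ φ ∨ Null univ ψ ∨ Null univ (φ + ψ))
    (hF0 : ¬ Null univ (pull F (pointClass n)))
    (hgood : ∀ V V' : Set M, IsChart n V → IsChart n V' → Good n V → Good n V') :
    ∃! q, τ q = q := by
  classical
  let δ : M → ZMod 2 := fun x => if τ x = x then 1 else 0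
  obtain ⟨s, hs, hsF⟩ := exists_signs hττ hFτ (δ := δ) (fun x hx => if_pos hx)
    fun x hx => if_neg hx
  have hδτ : δ ∘ τ = δ := by
    funext x
    simp only [δ, Function.comp_apply, hττ x, eq_comm]
  have hev : ∀ x k, F x k ≠ 0 → ∀ᶠ y in 𝓝 x,
      s k y = s k x ∧ (if 0 < F y k then 1 else 0) = s k y := fun x k hx => by
    have hk : ContinuousAt (fun y => F y k) x := ((continuous_apply k).comp hF).continuousAt
    filter_upwards [eventually_indicator hk hx, hk.eventually_ne hx] with y hy hy'
    rw [hsF k x hx, hsF k y hy', hy]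
    exact ⟨rfl, rfl⟩
  have hFne : ∀ x, x ∉ F ⁻¹' {0} → ∃ k, F x k ≠ 0 := fun x hx => by
    by_contra! h
    exact hx (funext h)
  set b := tower τ δ n s with hb
  have hbcs : ∀ j, CS univ (b j) := fun j => by
    refine ⟨_, hFc, subset_univ _, fun x hx => ?_⟩
    obtain ⟨k, hk⟩ := hFne x hx
    refine locZero_tower τ δ n s k ((hev x k hk).mono fun _ h => h.1) ?_ j
    have hk' : ContinuousAt (fun y => F y k) x := ((continuous_apply k).comp hF).continuousAt
    filter_upwards [hk'.eventually_ne hk] with y hy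
    refine if_neg fun h => hy ?_
    have := congrFun (hFτ y) k
    rw [h, Pi.neg_apply] at this
    linarith
  have hb0 : b 0 = cupF n s := tower_zero τ δ n s
  have hbcyc : Cyc id univ (n + 1) (b 0) := by
    refine ⟨hbcs 0, hb0 ▸ deg_cupF n s, pull_id _, ?_⟩
    rw [hb0, d_cupF]
    exact lz_zero
  have hbnull : ¬ Null univ (b 0) := by
    intro h
    obtain ⟨E, h0, hE, hE'⟩ := exists_cupF_add_cupF n s fun k x => if 0 < F x k then 1 else 0
    have h1 : pull F (pointClass n) = cupF n fun k x => if 0 < F x k then 1 else 0 :=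
      pull_cupF F n _
    rw [← hb0, ← h1] at hE
    refine hF0 (Null.congr_right (φ := b 0) ?_ h)
    rw [hE]
    refine Null.of_d h0 ⟨_, hFc, subset_univ _, fun x hx => hE' x ?_⟩
    obtain ⟨k, hk⟩ := hFne x hx
    exact ⟨k, hev x k hk⟩
  have hsum : ∀ e, Cyc id univ (n + 1) e → ¬ Null univ e → Null univ (e + b 0) :=
    fun e he hne => ((htop e (b 0) he hbcyc).resolve_left hne).resolve_left hbnull
  have hbd := d_tower hττ hδτ n s hs
  obtain ⟨p, hp⟩ : ∃ p, τ p = p := by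
    by_contra! hfree
    have hδ0 : δ = 0 := funext fun x => if_neg (hfree x)
    have hinv := hbd 0
    rw [hδ0, tower_succ_eq_zero, d_zero, ← hδ0] at hinv
    refine hbnull (hM.null_of_free hτ hττ hfree (fun e he => ?_)
      ⟨hbcs 0, hbcyc.deg, ?_, hbcyc.lz⟩)
    · have h2 : Null univ e → Null univ (pull τ e) := fun h => h.pull_involutive hτ hττ
      rcases htop e _ he (he.pull_involutive hτ hττ) with h | h | h
      · exact h.add (h2 h)
      · have := h.pull_involutive hτ hττ
        rw [pull_pull_involutive hττ] at this
        exact NullI.add this h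
      · exact h
    · rw [hb]
      grind
  refine ⟨p, hp, fun q hq => by_contra fun hqp => ?_⟩
  obtain ⟨V, hV, hVG⟩ := hM.exists_good hbcyc hbnull
  obtain ⟨U, U', hU, hU', hpU, hqU', hUU'⟩ := t2_separation (Ne.symm hqp)
  obtain ⟨β, a, c, hβ, -, -, hck, hlz⟩ := exists_localized hM hτ hττ hvan
    (fun V' hV' => hgood V V' hV hV' hVG) (fun j k hjk => deg_tower τ δ n s hjk) hbcs hbd hsum
    hp n 1 (by omega) U hU hpU
  obtain ⟨K, -, hKU, hβK⟩ := hβ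
  obtain ⟨N, hN, h1⟩ := hβK q fun h => Set.disjoint_left.1 hUU' (hKU h) hqU'
  obtain ⟨N', hN', h2⟩ := hlz q
  have h3 := h1 [q] (by simpa using mem_of_mem_nhds hN)
  have h4 := h2 [q] (by simpa using mem_of_mem_nhds hN')
  have h5 : b n [q] = 1 := tower_apply_singleton τ δ n s hq (if_pos hq)
  have h6 : pull τ a [q] = a [q] := by rw [pull_apply, List.map_singleton, hq]
  simp only [Pi.add_apply, h3, h6, d_singleton, hck.1] at h4
  grind

end AlexanderSpanier

namespace AlexanderSpanier

open Set Topology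

/-- The universal covering `ℝⁿ → Tⁿ`. -/
def torusProj (n : ℕ) (v : Fin n → ℝ) : Fin n → AddCircle (1 : ℝ) :=
  fun i => (v i : AddCircle (1 : ℝ))

lemma continuous_torusProj (n : ℕ) : Continuous (torusProj n) :=
  continuous_pi fun i => (AddCircle.continuous_mk' 1).comp (continuous_apply i)

lemma torusProj_add {n : ℕ} (v w : Fin n → ℝ) :
    torusProj n (v + w) = torusProj n v + torusProj n w := rfl

lemma torusProj_sub {n : ℕ} (v w : Fin n → ℝ) :
    torusProj n (v - w) = torusProj n v - torusProj n w := rfl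

lemma torusProj_neg {n : ℕ} (v : Fin n → ℝ) : torusProj n (-v) = -torusProj n v := rfl

lemma torusProj_zero (n : ℕ) : torusProj n 0 = 0 := rfl

lemma torusProj_surjective (n : ℕ) : Function.Surjective (torusProj n) := fun y =>
  ⟨fun i => (QuotientAddGroup.mk_surjective (y i)).choose,
    funext fun i => (QuotientAddGroup.mk_surjective (y i)).choose_spec⟩

lemma exists_int_of_torusProj_eq_zero {n : ℕ} {v : Fin n → ℝ} (h : torusProj n v = 0) (i : Fin n) :
    ∃ k : ℤ, (k : ℝ) = v i := by
  obtain ⟨k, hk⟩ := AddCircle.coe_eq_zero_iff (1 : ℝ) |>.1 (congrFun h i)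
  exact ⟨k, by simpa using hk⟩

lemma eq_of_torusProj_eq_zero {N : Type*} [TopologicalSpace N] [PreconnectedSpace N] {n : ℕ}
    {m : N → Fin n → ℝ} (hm : Continuous m) (h : ∀ x, torusProj n (m x) = 0) (x y : N) :
    m x = m y := by
  funext i
  choose k hk using fun x => exists_int_of_torusProj_eq_zero (h x) i
  have hc : Continuous k := by
    rw [Int.isClosedEmbedding_coe_real.isEmbedding.continuous_iff]
    refine ((continuous_apply i).comp hm).congr fun x => (hk x).symm
  rw [← hk, ← hk, PreconnectedSpace.constant inferInstance hc (x := x) (y := y)]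

lemma exists_lift_homotopy {Y : Type*} [TopologicalSpace Y] {n : ℕ}
    (L : C(unitInterval × Y, Fin n → AddCircle (1 : ℝ))) (hL : ∀ y, L (0, y) = 0) :
    ∃ L' : C(unitInterval × Y, Fin n → ℝ), (∀ y, L' (0, y) = 0) ∧
      ∀ p, torusProj n (L' p) = L p := by
  have cov := AddCircle.isCoveringMap_coe (1 : ℝ)
  let Li : Fin n → C(unitInterval × Y, AddCircle (1 : ℝ)) := fun i =>
    ⟨fun p => L p i, (continuous_apply i).comp L.continuous⟩
  have h0 : ∀ i y, Li i (0, y) = (((0 : C(Y, ℝ)) y : ℝ) : AddCircle (1 : ℝ)) := fun i y =>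
    congrFun (hL y) i
  refine ⟨⟨fun p i => cov.liftHomotopy (Li i) 0 (h0 i) p, by fun_prop⟩, fun y => funext fun i => ?_,
    fun p => funext fun i => ?_⟩
  · exact cov.liftHomotopy_zero (Li i) 0 (h0 i) y
  · exact congrFun (cov.liftHomotopy_lifts (Li i) 0 (h0 i)) p

lemma exists_dist_lt {Z W : Type*} [TopologicalSpace Z] [CompactSpace Z] [PseudoMetricSpace W]
    (G : C(unitInterval × Z, W)) {ε : ℝ} (hε : 0 < ε) :
    ∃ δ > 0, ∀ s t : unitInterval, |(s : ℝ) - t| < δ → ∀ z, dist (G (s, z)) (G (t, z)) < ε := by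
  have := CompactSpace.uniformContinuous_of_continuous (G.curry).continuous
  obtain ⟨δ, hδ, h⟩ := Metric.uniformContinuous_iff.1 this ε hε
  exact ⟨δ, hδ, fun s t hst z => (ContinuousMap.dist_apply_le_dist z).trans_lt (h hst)⟩

lemma exists_norm_le {Z E : Type*} [TopologicalSpace Z] [CompactSpace Z] [NormedAddCommGroup E]
    {f : Z → E} (hf : Continuous f) : ∃ b, ∀ z, ‖f z‖ ≤ b := by
  obtain ⟨b, hb⟩ := (isCompact_range hf).isBounded.exists_norm_le
  exact ⟨b, fun z => hb _ ⟨z, rfl⟩⟩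

lemma PropHomotopy.of_bounded {X Y E : Type*} [TopologicalSpace X] [PseudoMetricSpace Y]
    [NormedAddCommGroup E] {p : X → E} {q : Y → E} (hp : ∀ R, IsCompact {x | ‖p x‖ ≤ R})
    (hq : Continuous q) {H : ℝ → X → Y} (hc : ∀ t ∈ Icc (0 : ℝ) 1, Continuous (H t))
    (hu : ∀ ε > 0, ∃ δ > 0, ∀ s ∈ Icc (0 : ℝ) 1, ∀ t ∈ Icc (0 : ℝ) 1, |s - t| < δ →
      ∀ x, dist (H s x) (H t x) < ε) {b : ℝ}
    (hb : ∀ t ∈ Icc (0 : ℝ) 1, ∀ x, ‖q (H t x) - p x‖ ≤ b) : PropHomotopy H where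
  cont := hc
  unif := hu
  proper K hK := by
    obtain ⟨R, hR⟩ := (hK.image hq).isBounded.exists_norm_le
    refine ⟨_, hp (R + b), fun x hx t ht hK => hx ?_⟩
    have h1 := hR _ ⟨_, hK, rfl⟩
    have h2 := hb t ht x
    have h3 := norm_sub_norm_le (p x) (q (H t x))
    rw [norm_sub_rev] at h3
    simp only [mem_ofPred_eq]
    linarith

variable {N : Type*} {n : ℕ}

/-- The pullback of the universal covering of the torus along `F`. -/
abbrev PullCover (F : N → Fin n → AddCircle (1 : ℝ)) : Type _ :=
  {z : N × (Fin n → ℝ) // F z.1 = torusProj n z.2}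

namespace PullCover

variable {F : N → Fin n → AddCircle (1 : ℝ)}

/-- The projection to the base. -/
def fst (z : PullCover F) : N := z.1.1

/-- The projection to `ℝⁿ`. -/
def snd (z : PullCover F) : Fin n → ℝ := z.1.2

lemma map_fst (z : PullCover F) : F z.fst = torusProj n z.snd := z.2

lemma ext' {z w : PullCover F} (h : z.fst = w.fst) (h' : z.snd = w.snd) : z = w :=
  Subtype.ext (Prod.ext h h')

lemma continuous_fst [TopologicalSpace N] : Continuous (fst : PullCover F → N) :=
  _root_.continuous_fst.comp continuous_subtype_val

lemma continuous_snd [TopologicalSpace N] : Continuous (snd : PullCover F → Fin n → ℝ) :=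
  _root_.continuous_snd.comp continuous_subtype_val

/-- The point of the pullback over `x` and `v`. -/
def mk (x : N) (v : Fin n → ℝ) (h : F x = torusProj n v) : PullCover F := ⟨(x, v), h⟩

lemma continuous_mk [TopologicalSpace N] {X : Type*} [TopologicalSpace X] {f : X → N}
    {g : X → Fin n → ℝ}
    (hf : Continuous f) (hg : Continuous g) (h : ∀ x, F (f x) = torusProj n (g x)) :
    Continuous fun x => mk (f x) (g x) (h x) :=
  (hf.prodMk hg).subtype_mk h

/-- The deck transformation by a period. -/
def translate (m : Fin n → ℝ) (hm : torusProj n m = 0) (z : PullCover F) : PullCover F :=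
  mk z.fst (z.snd + m) (by rw [torusProj_add, hm, add_zero]; exact z.map_fst)

lemma isClosed_range [TopologicalSpace N] (hF : Continuous F) :
    IsClosed {z : N × (Fin n → ℝ) | F z.1 = torusProj n z.2} :=
  isClosed_eq (hF.comp _root_.continuous_fst) ((continuous_torusProj n).comp _root_.continuous_snd)

lemma isCompact_snd_le [TopologicalSpace N] [CompactSpace N] (hF : Continuous F) (R : ℝ) :
    IsCompact {z : PullCover F | ‖z.snd‖ ≤ R} := by
  have h := (isClosed_range hF).isClosedEmbedding_subtypeVal.isCompact_preimage
    (isCompact_univ.prod (isCompact_closedBall (0 : Fin n → ℝ) R))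
  have e : {z : PullCover F | ‖z.snd‖ ≤ R} =
      Subtype.val ⁻¹' (univ ×ˢ Metric.closedBall (0 : Fin n → ℝ) R) :=
    Set.ext fun z => by
      change ‖z.1.2‖ ≤ R ↔ z.1 ∈ univ ×ˢ Metric.closedBall (0 : Fin n → ℝ) R
      simp
  rw [e]
  exact h

lemma locallyCompactSpace [TopologicalSpace N] [LocallyCompactSpace N] (hF : Continuous F) :
    LocallyCompactSpace (PullCover F) :=
  (isClosed_range hF).isClosedEmbedding_subtypeVal.locallyCompactSpace

lemma isCompact_preimage_snd [TopologicalSpace N] [CompactSpace N] (hF : Continuous F)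
    {K : Set (Fin n → ℝ)} (hK : IsCompact K) : IsCompact ((snd : PullCover F → _) ⁻¹' K) := by
  obtain ⟨R, hR⟩ := hK.isBounded.exists_norm_le
  exact (isCompact_snd_le hF R).of_isClosed_subset (hK.isClosed.preimage continuous_snd)
    fun z hz => hR _ hz

section Translate

variable [TopologicalSpace N] {m : Fin n → ℝ} (hm : torusProj n m = 0)

/-- The deck transformation by a period, as a homeomorphism. -/
def translateHomeomorph : PullCover F ≃ₜ PullCover F where
  toFun := translate m hm
  invFun := translate (-m) (by rw [torusProj_neg, hm, neg_zero])
  left_inv z := ext' rfl (add_neg_cancel_right _ _)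
  right_inv z := ext' rfl (neg_add_cancel_right _ _)
  continuous_toFun := continuous_mk continuous_fst (continuous_snd.add continuous_const) _
  continuous_invFun := continuous_mk continuous_fst (continuous_snd.add continuous_const) _

end Translate

end PullCover

end AlexanderSpanier

namespace AlexanderSpanier

open Set Topology

variable {N : Type*} {n : ℕ}

namespace PullCover

lemma dist_lt [MetricSpace N] {F : N → Fin n → AddCircle (1 : ℝ)} {z w : PullCover F} {ε : ℝ}
    (h : dist z.fst w.fst < ε) (h' : dist z.snd w.snd < ε) : dist z w < ε :=
  max_lt h h'

end PullCover

open PullCover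

lemma abs_projIcc_sub_lt {s t δ : ℝ} (hs : s ∈ Icc (0 : ℝ) 1) (ht : t ∈ Icc (0 : ℝ) 1)
    (h : |s - t| < δ) :
    |(projIcc (0 : ℝ) 1 zero_le_one s : ℝ) - projIcc (0 : ℝ) 1 zero_le_one t| < δ := by
  rwa [projIcc_of_mem _ hs, projIcc_of_mem _ ht]

/-- Bounded data lifting a homotopy equivalence between `N` and the torus. -/
structure LiftedEquiv [TopologicalSpace N] (F : N → Fin n → AddCircle (1 : ℝ)) where
  g : (Fin n → AddCircle (1 : ℝ)) → N
  hF : Continuous F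
  hg : Continuous g
  D : C(unitInterval × (Fin n → AddCircle (1 : ℝ)), Fin n → ℝ)
  D_zero : ∀ y, D (0, y) = 0
  D_one : ∀ y, torusProj n (D (1, y)) = F (g y) - y
  H : C(unitInterval × N, N)
  H_zero : ∀ x, H (0, x) = g (F x)
  H_one : ∀ x, H (1, x) = x
  E : C(unitInterval × N, Fin n → ℝ)
  E_zero : ∀ x, E (0, x) = 0
  E_lift : ∀ p, torusProj n (E p) = F (H p) - F (H (0, p.2))

lemma nonempty_liftedEquiv [TopologicalSpace N] (F : C(N, Fin n → AddCircle (1 : ℝ)))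
    (g : C(Fin n → AddCircle (1 : ℝ), N)) (h : (F.comp g).Homotopic (ContinuousMap.id _))
    (h' : (g.comp F).Homotopic (ContinuousMap.id _)) : Nonempty (LiftedEquiv F) := by
  obtain ⟨D⟩ := h.symm
  obtain ⟨H⟩ := h'
  obtain ⟨D', hD0, hD⟩ := exists_lift_homotopy ⟨fun p => D p - p.2, by fun_prop⟩ (by simp)
  obtain ⟨E, hE0, hE⟩ := exists_lift_homotopy ⟨fun p => F (H p) - F (H (0, p.2)), by fun_prop⟩
    (by simp)
  exact ⟨⟨g, F.continuous, g.continuous, D', hD0, fun y => by simp [hD], H.toContinuousMap,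
    fun x => by simp, fun x => by simp, E, hE0, hE⟩⟩

namespace LiftedEquiv

variable [MetricSpace N] {F : N → Fin n → AddCircle (1 : ℝ)} (Φ : LiftedEquiv F)

/-- The displaced identity of `ℝⁿ` lifting `F ∘ g`. -/
def shift (v : Fin n → ℝ) : Fin n → ℝ := v + Φ.D (1, torusProj n v)

lemma continuous_shift : Continuous Φ.shift := by
  have := continuous_torusProj n
  unfold shift
  fun_prop

lemma torusProj_shift (v : Fin n → ℝ) : torusProj n (Φ.shift v) = F (Φ.g (torusProj n v)) := by
  rw [shift, torusProj_add, Φ.D_one, add_sub_cancel]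

/-- The lift of `g` to the covers. -/
def lift (v : Fin n → ℝ) : PullCover F :=
  PullCover.mk (Φ.g (torusProj n v)) (Φ.shift v) (Φ.torusProj_shift v).symm

lemma continuous_lift : Continuous Φ.lift :=
  continuous_mk (Φ.hg.comp (continuous_torusProj n)) Φ.continuous_shift _

lemma null_shift {k : ℕ} {φ : Cochain (Fin n → ℝ)} (hφ : Cyc id univ k φ) :
    Null univ (φ + AlexanderSpanier.pull Φ.shift φ) := by
  obtain ⟨b, hb⟩ := exists_norm_le Φ.D.continuous
  have hH : PropHomotopy fun (t : ℝ) (v : Fin n → ℝ) =>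
      v + Φ.D (projIcc (0 : ℝ) 1 zero_le_one t, torusProj n v) := by
    refine .of_bounded (p := id) (q := id) (fun R => ?_) continuous_id (fun t ht => ?_)
      (fun ε hε => ?_) (b := b) fun t ht x => ?_
    · simpa [Metric.closedBall, dist_eq_norm] using isCompact_closedBall (0 : Fin n → ℝ) R
    · have := continuous_torusProj n
      fun_prop
    · obtain ⟨δ, hδ, h⟩ := exists_dist_lt Φ.D hε
      refine ⟨δ, hδ, fun s hs t ht hst x => ?_⟩
      rw [dist_add_left]
      exact h _ _ (abs_projIcc_sub_lt hs ht hst) _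
    · simpa using hb _
  have := hH.null hφ
  have h0 : (fun v => v + Φ.D (projIcc (0 : ℝ) 1 zero_le_one 0, torusProj n v)) = id :=
    funext fun v => by
      rw [projIcc_left]
      exact (congrArg _ (Φ.D_zero _)).trans (add_zero _)
  have h1 : (fun v => v + Φ.D (projIcc (0 : ℝ) 1 zero_le_one 1, torusProj n v)) = Φ.shift :=
    funext fun v => by
      rw [projIcc_right]
      rfl
  rwa [h0, h1, pull_id] at this

/-- The homotopy of the cover lifting `H`, from `lift ∘ snd`. -/
noncomputable def homotopy (t : ℝ) (z : PullCover F) : PullCover F :=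
  PullCover.mk (Φ.H (projIcc 0 1 zero_le_one t, z.fst))
    (Φ.shift z.snd + Φ.E (projIcc 0 1 zero_le_one t, z.fst)) (by
      rw [torusProj_add, torusProj_shift, Φ.E_lift, Φ.H_zero, ← z.map_fst, add_sub_cancel])

variable [CompactSpace N]

lemma propHomotopy_homotopy : PropHomotopy Φ.homotopy := by
  obtain ⟨b, hb⟩ := exists_norm_le Φ.D.continuous
  obtain ⟨c, hc⟩ := exists_norm_le Φ.E.continuous
  refine .of_bounded (p := snd) (q := snd) (isCompact_snd_le Φ.hF) continuous_snd
    (fun t ht => ?_) (fun ε hε => ?_) (b := b + c) fun t ht x => ?_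
  · have h1 := PullCover.continuous_fst (F := F)
    have h2 := PullCover.continuous_snd (F := F)
    have h3 := Φ.continuous_shift
    exact continuous_mk (by fun_prop) (by fun_prop) _
  · obtain ⟨δ, hδ, h⟩ := exists_dist_lt Φ.H hε
    obtain ⟨δ', hδ', h'⟩ := exists_dist_lt Φ.E hε
    refine ⟨min δ δ', lt_min hδ hδ', fun s hs t ht hst x => dist_lt ?_ ?_⟩
    · exact h _ _ (abs_projIcc_sub_lt hs ht (hst.trans_le (min_le_left _ _))) _
    · change dist (_ + _) (_ + _) < ε
      rw [dist_add_left]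
      exact h' _ _ (abs_projIcc_sub_lt hs ht (hst.trans_le (min_le_right _ _))) _
  · have : snd (Φ.homotopy t x) - x.snd =
        Φ.D (1, torusProj n x.snd) + Φ.E (projIcc 0 1 zero_le_one t, x.fst) := by
      change x.snd + _ + _ - x.snd = _
      abel
    rw [this]
    exact (norm_add_le _ _).trans (add_le_add (hb _) (hc _))

omit [CompactSpace N] in
lemma homotopy_zero : Φ.homotopy 0 = Φ.lift ∘ snd := by
  funext z
  refine ext' ?_ ?_
  · change Φ.H (projIcc 0 1 zero_le_one 0, z.fst) = Φ.g (torusProj n z.snd)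
    rw [projIcc_left, ← map_fst]
    exact Φ.H_zero _
  · change Φ.shift z.snd + Φ.E (projIcc 0 1 zero_le_one 0, z.fst) = Φ.shift z.snd
    rw [projIcc_left]
    exact (congrArg _ (Φ.E_zero _)).trans (add_zero _)

lemma exists_homotopy_one [ConnectedSpace N] :
    ∃ (m : Fin n → ℝ) (hm : torusProj n m = 0), Φ.homotopy 1 = translate m hm := by
  have key : ∀ x, torusProj n (Φ.D (1, F x) + Φ.E (1, x)) = 0 := fun x => by
    rw [torusProj_add, Φ.D_one, Φ.E_lift, Φ.H_zero, Φ.H_one]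
    abel
  obtain ⟨x₀⟩ : Nonempty N := inferInstance
  refine ⟨_, key x₀, funext fun z => ext' ?_ ?_⟩
  · exact (congrArg (fun t => Φ.H (t, z.fst)) (projIcc_right _)).trans (Φ.H_one _)
  · have hc := Φ.hF
    have hz := eq_of_torusProj_eq_zero (m := fun x => Φ.D (1, F x) + Φ.E (1, x)) (by fun_prop) key
      x₀ z.fst
    change z.snd + Φ.D (1, torusProj n z.snd) + Φ.E (projIcc 0 1 zero_le_one 1, z.fst) =
      z.snd + (Φ.D (1, F x₀) + Φ.E (1, x₀))
    rw [projIcc_right, hz, z.map_fst, add_assoc]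
    rfl

lemma null_of_null_lift [ConnectedSpace N] {k : ℕ} {φ : Cochain (PullCover F)}
    (hφ : Cyc id univ k φ) (h : Null univ (AlexanderSpanier.pull Φ.lift φ)) : Null univ φ := by
  obtain ⟨m, hm, h1⟩ := Φ.exists_homotopy_one
  have := PullCover.locallyCompactSpace (F := F) Φ.hF
  have h2 := Φ.propHomotopy_homotopy.null hφ
  rw [homotopy_zero, ← pull_pull, h1] at h2
  have h3 : Null univ (AlexanderSpanier.pull (translate m hm) φ) :=
    h2.congr_right (h.pull PullCover.continuous_snd
      (fun K _ hK => isCompact_preimage_snd Φ.hF hK) (subset_univ _))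
  let e : PullCover F ≃ₜ PullCover F := translateHomeomorph hm
  have h4 := h3.pull (f := e.symm) (V := univ) e.symm.continuous
    (fun K _ hK => e.symm.isClosedEmbedding.isCompact_preimage hK) (subset_univ _)
  have h5 : translate m hm ∘ e.symm = id := funext fun z => e.apply_symm_apply z
  rwa [pull_pull, h5, pull_id] at h4

omit [CompactSpace N] in
lemma isCompact_preimage_lift {K : Set (PullCover F)} (hK : IsCompact K) :
    IsCompact (Φ.lift ⁻¹' K) := by
  obtain ⟨b, hb⟩ := exists_norm_le Φ.D.continuous
  obtain ⟨R, hR⟩ := (hK.image continuous_snd).isBounded.exists_norm_le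
  refine (isCompact_closedBall (0 : Fin n → ℝ) (R + b)).of_isClosed_subset
    (hK.isClosed.preimage Φ.continuous_lift) fun v hv => ?_
  have h1 : ‖v + Φ.D (1, torusProj n v)‖ ≤ R := hR _ ⟨_, hv, rfl⟩
  have h2 := norm_sub_le (v + Φ.D (1, torusProj n v)) (Φ.D (1, torusProj n v))
  rw [add_sub_cancel_right] at h2
  rw [mem_closedBall_zero_iff]
  linarith [hb (1, torusProj n v)]

omit [CompactSpace N] in
lemma cyc_lift {k : ℕ} {φ : Cochain (PullCover F)} (hφ : Cyc id univ k φ) :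
    Cyc id univ k (AlexanderSpanier.pull Φ.lift φ) :=
  hφ.pull Φ.continuous_lift (fun _ _ hK => Φ.isCompact_preimage_lift hK) (subset_univ _)

include Φ

omit [CompactSpace N] in
lemma not_null_pointClass :
    ¬ Null univ (AlexanderSpanier.pull (snd : PullCover F → _) (pointClass n)) := by
  intro h
  have h1 := h.pull (V := univ) Φ.continuous_lift (fun _ _ hK => Φ.isCompact_preimage_lift hK)
    (subset_univ _)
  rw [pull_pull] at h1
  exact AlexanderSpanier.not_null_pointClass n
    ((Φ.null_shift (cyc_pointClass n (mem_univ _))).congr h1)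

variable [ConnectedSpace N]

lemma null_of_lt {k : ℕ} (hk : k < n + 1) {φ : Cochain (PullCover F)} (hφ : Cyc id univ k φ) :
    Null univ φ :=
  (null_or_of_euclidean (Φ.cyc_lift hφ)).elim (Φ.null_of_null_lift hφ) fun h => absurd h.1 hk.ne

lemma null_or {φ ψ : Cochain (PullCover F)} (hφ : Cyc id univ (n + 1) φ)
    (hψ : Cyc id univ (n + 1) ψ) : Null univ φ ∨ Null univ ψ ∨ Null univ (φ + ψ) := by
  rcases null_or_of_euclidean (Φ.cyc_lift hφ) with h | ⟨-, h⟩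
  · exact .inl (Φ.null_of_null_lift hφ h)
  rcases null_or_of_euclidean (Φ.cyc_lift hψ) with h' | ⟨-, h'⟩
  · exact .inr (.inl (Φ.null_of_null_lift hψ h'))
  refine .inr (.inr (Φ.null_of_null_lift (hφ.add hψ) ?_))
  rw [pull_add]
  convert h.add h' using 1
  generalize AlexanderSpanier.pull Φ.lift φ = a, AlexanderSpanier.pull Φ.lift ψ = b,
    pointClass n = c
  clear * -
  grind

end LiftedEquiv

end AlexanderSpanier

namespace AlexanderSpanier

open Set Topology

lemma isLocalHomeomorph_torusProj (n : ℕ) : IsLocalHomeomorph (torusProj n) :=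
  .mk _ fun v => ⟨.pi fun i => AddCircle.openPartialHomeomorphCoe (1 : ℝ) (v i - 1 / 2),
    fun i _ => ⟨by simp, by linarith⟩, fun _ _ => rfl⟩

variable {n : ℕ}

namespace PullCover

variable {N : Type*} [TopologicalSpace N] {F : N → Fin n → AddCircle (1 : ℝ)}

lemma isLocalHomeomorph_fst (hF : Continuous F) : IsLocalHomeomorph (fst : PullCover F → N) := by
  refine .mk _ fun z => ?_
  obtain ⟨e, hz, he⟩ := isLocalHomeomorph_torusProj n z.snd
  have hinv : ∀ x (h : F x ∈ e.target), F x = torusProj n (e.symm (F x)) := fun x h => by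
    rw [he, e.right_inv h]
  classical
  let s : N → PullCover F := fun x =>
    if h : F x ∈ e.target then mk x (e.symm (F x)) (hinv x h) else z
  have hs : ∀ x (h : F x ∈ e.target), s x = mk x (e.symm (F x)) (hinv x h) := fun x h => dif_pos h
  refine ⟨⟨⟨⟨fst, s, snd ⁻¹' e.source, F ⁻¹' e.target, fun w hw => ?_, fun x hx => ?_,
    fun w hw => ?_, fun x hx => ?_⟩, continuous_fst.continuousOn, ?_⟩,
    e.open_source.preimage continuous_snd, e.open_target.preimage hF⟩, hz, fun _ _ => rfl⟩
  · rw [mem_preimage, map_fst (F := F), he]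
    exact e.map_source hw
  · rw [mem_preimage, hs x hx]
    exact e.map_target hx
  · have h : F w.fst ∈ e.target := by
      rw [map_fst (F := F), he]
      exact e.map_source hw
    rw [hs _ h]
    refine ext' rfl ?_
    change e.symm (F w.fst) = w.snd
    rw [map_fst (F := F), he, e.left_inv hw]
  · rw [hs x hx]
    rfl
  · rw [continuousOn_iff_continuous_domRestrict]
    have hc : Continuous fun x : F ⁻¹' e.target => e.symm (F x) :=
      e.continuousOn_symm.comp_continuous (hF.comp continuous_subtype_val) fun x => x.2
    exact (continuous_mk continuous_subtype_val hc fun x => hinv x x.2).congr fun x =>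
      (hs x x.2).symm

end PullCover

lemma HasCharts.of_isLocalHomeomorph {M N : Type*} [TopologicalSpace M] [TopologicalSpace N]
    (hN : HasCharts n N) {p : M → N} (hp : IsLocalHomeomorph p) : HasCharts n M := by
  intro z U hU
  obtain ⟨e, hz, he⟩ := hp z
  obtain ⟨V, ⟨j, hj, rfl⟩, hzV, hVU⟩ := hN (e z) (e.target ∩ e.symm ⁻¹' U)
    (Filter.inter_mem (e.open_target.mem_nhds (e.map_source hz))
      ((e.continuousAt_symm (e.map_source hz)).preimage_mem_nhds (by rwa [e.left_inv hz])))
  have hjt : ∀ v, j v ∈ e.target := fun v => (hVU ⟨v, rfl⟩).1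
  refine ⟨range (e.symm ∘ j), ⟨e.symm ∘ j, ?_, rfl⟩, ?_, ?_⟩
  · refine .of_continuous_injective_isOpenMap
      (e.continuousOn_symm.comp_continuous hj.continuous hjt)
      (fun v w h => hj.injective (e.symm.injOn (hjt v) (hjt w) h)) fun O hO => ?_
    rw [image_comp]
    exact e.symm.isOpen_image_of_subset_source (hj.isOpenMap O hO)
      (image_subset_iff.2 fun v _ => hjt v)
  · obtain ⟨v, hv⟩ := hzV
    exact ⟨v, by rw [Function.comp_apply, hv, e.left_inv hz]⟩
  · rintro _ ⟨v, rfl⟩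
    exact (hVU ⟨v, rfl⟩).2

lemma hasCharts_euclidean (n : ℕ) : HasCharts n (Fin n → ℝ) := by
  intro v U hU
  obtain ⟨r, hr, h⟩ := Metric.mem_nhds_iff.1 hU
  refine ⟨_, isChart_box (a := fun i => v i - r) (b := fun i => v i + r) fun i => by linarith,
    fun i _ => ⟨by linarith, by linarith⟩, fun w hw => h ?_⟩
  rw [ball_pi _ hr]
  intro i hi
  have := hw i hi
  change w i ∈ Metric.ball (v i) r
  rw [Real.ball_eq_Ioo]
  exact this

lemma IsChart.image {M N : Type*} [TopologicalSpace M] [TopologicalSpace N] {V : Set M}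
    (hV : IsChart n V) {j : M → N} (hj : IsOpenEmbedding j) : IsChart n (j '' V) := by
  obtain ⟨i, hi, rfl⟩ := hV
  exact ⟨j ∘ i, hj.comp hi, range_comp _ _⟩

end AlexanderSpanier

open Set Topology AlexanderSpanier in
lemma LocallyEuclidean.hasCharts {n : ℕ} {N : Type} [TopologicalSpace N]
    (h : LocallyEuclidean n N) : HasCharts n N := by
  intro x O hO
  obtain ⟨U, V, hU, hx, hV, ⟨e⟩⟩ := h x
  have h1 : HasCharts n V :=
    (hasCharts_euclidean n).of_isLocalHomeomorph hV.isOpenEmbedding_subtypeVal.isLocalHomeomorph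
  have h2 : IsOpenEmbedding (Subtype.val ∘ e.symm) :=
    hU.isOpenEmbedding_subtypeVal.comp e.symm.isOpenEmbedding
  have h3 : (Subtype.val ∘ e.symm) (e ⟨x, hx⟩) = x := by simp
  obtain ⟨W, hW, hxW, hWO⟩ := h1 (e ⟨x, hx⟩) ((Subtype.val ∘ e.symm) ⁻¹' O)
    (h2.continuous.continuousAt.preimage_mem_nhds (by rwa [h3]))
  exact ⟨_, hW.image h2, ⟨_, hxW, h3⟩, image_subset_iff.2 hWO⟩

namespace AlexanderSpanier

open Set Topology

lemma Good.image {n : ℕ} {M : Type*} [TopologicalSpace M] {V : Set M} (hV : Good n V)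
    (e : M ≃ₜ M) : Good n (e '' V) := by
  intro φ hφ h
  have hp : ∀ (e : M ≃ₜ M) (W : Set M), ∀ K ⊆ W, IsCompact K → IsCompact (e ⁻¹' K) :=
    fun e _ K _ hK => e.isClosedEmbedding.isCompact_preimage hK
  have h1 := hV _ (hφ.pull e.continuous (hp e _) (e.preimage_image V).subset)
    (h.pull e.continuous (hp e _) (subset_univ _))
  have h2 := h1.pull (V := e '' V) e.symm.continuous (hp e.symm _)
    (e.image_eq_preimage_symm V).superset
  rwa [pull_pull, e.self_comp_symm, pull_id] at h2

variable {N : Type*} {n : ℕ} {F : N → Fin n → AddCircle (1 : ℝ)}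

lemma PullCover.good_of_good [MetricSpace N] [CompactSpace N] [PreconnectedSpace N]
    (hF : Continuous F) (hN : HasCharts n N) {V V' : Set (PullCover F)} (hV : IsChart n V)
    (hV' : IsChart n V') (hG : Good n V) : Good n V' := by
  by_contra hB
  have hM := hN.of_isLocalHomeomorph (isLocalHomeomorph_fst hF)
  have := locallyCompactSpace hF
  have hopen : ∀ P : Set (PullCover F) → Prop,
      IsOpen (fst '' {z : PullCover F | ∃ V, IsChart n V ∧ z ∈ V ∧ P V}) := fun P => by
    refine (isLocalHomeomorph_fst hF).isOpenMap _ (isOpen_iff_mem_nhds.2 ?_)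
    rintro z ⟨V, hV, hz, hP⟩
    exact Filter.mem_of_superset (hV.isOpen.mem_nhds hz) fun w hw => ⟨V, hV, hw, hP⟩
  have hne : ∀ {V : Set (PullCover F)}, IsChart n V → ∃ z, z ∈ V := by
    rintro _ ⟨j, -, rfl⟩
    exact ⟨_, 0, rfl⟩
  obtain ⟨z, hz⟩ := hne hV
  obtain ⟨z', hz'⟩ := hne hV'
  obtain ⟨x, -, ⟨w, ⟨W, hW, hwW, hWG⟩, rfl⟩, ⟨w', ⟨W', hW', hwW', hWB⟩, hww'⟩⟩ :=
    isPreconnected_univ (α := N) _ _ (hopen (Good n)) (hopen fun V => ¬ Good n V)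
      (fun x _ => by
        obtain ⟨v, hv⟩ := torusProj_surjective n (F x)
        obtain ⟨V, hV, hz, -⟩ := hM (mk x v hv.symm) univ Filter.univ_mem
        by_cases h : Good n V
        · exact .inl ⟨_, ⟨V, hV, hz, h⟩, rfl⟩
        · exact .inr ⟨_, ⟨V, hV, hz, h⟩, rfl⟩)
      ⟨_, trivial, _, ⟨V, hV, hz, hG⟩, rfl⟩ ⟨_, trivial, _, ⟨V', hV', hz', hB⟩, rfl⟩
  have hm : torusProj n (w'.snd - w.snd) = 0 := by
    rw [torusProj_sub, ← map_fst (F := F), ← map_fst (F := F), hww', sub_self]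
  let e : PullCover F ≃ₜ PullCover F := translateHomeomorph hm
  have he : e w = w' := ext' hww'.symm (add_sub_cancel _ _)
  exact hWB ((hWG.image e).of_inter (hW.image e.isOpenEmbedding) hW' ⟨w', ⟨w, hwW, he⟩, hwW'⟩)

open PullCover in
theorem existsUnique_fixed_zero [MetricSpace N] [CompactSpace N] [ConnectedSpace N]
    (hN : HasCharts n N) (Φ : LiftedEquiv F) {σ : N → N} (hσ : Continuous σ)
    (hσσ : Function.Involutive σ) (hodd : ∀ x, F (σ x) = -F x) : ∃! x, σ x = x ∧ F x = 0 := by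
  have := locallyCompactSpace Φ.hF
  have hτ' : ∀ z : PullCover F, F (σ z.fst) = torusProj n (-z.snd) := fun z => by
    rw [hodd, torusProj_neg, map_fst (F := F)]
  let τ : PullCover F → PullCover F := fun z => mk (σ z.fst) (-z.snd) (hτ' z)
  have hτ : Continuous τ := continuous_mk (hσ.comp PullCover.continuous_fst)
    PullCover.continuous_snd.neg _
  obtain ⟨z, hz, huniq⟩ := existsUnique_fixed (n := n)
    (hN.of_isLocalHomeomorph (isLocalHomeomorph_fst Φ.hF)) hτ
    (fun z => ext' (hσσ z.fst) (neg_neg z.snd)) PullCover.continuous_snd (fun _ => rfl)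
    (isCompact_preimage_snd Φ.hF isCompact_singleton) (fun k hk φ hφ => Φ.null_of_lt hk hφ)
    (fun φ ψ hφ hψ => Φ.null_or hφ hψ) Φ.not_null_pointClass
    (fun V V' hV hV' hG => good_of_good Φ.hF hN hV hV' hG)
  refine ⟨z.fst, ⟨congrArg fst hz, ?_⟩, fun x hx => ?_⟩
  · have h0 : z.snd = 0 := self_eq_neg.1 (congrArg snd hz).symm
    rw [map_fst (F := F), h0, torusProj_zero]
  · exact congrArg fst (huniq (mk x 0 hx.2) (ext' hx.1 neg_zero))

end AlexanderSpanier

namespace AlexanderSpanier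

open Set Topology

open unitInterval

section Winding

variable {a b c : AddCircle (1 : ℝ)}

lemma exists_path_lift (α : Path a b) : ∃ Γ : C(I, ℝ), ∀ t, (Γ t : AddCircle (1 : ℝ)) = α t := by
  obtain ⟨e, he⟩ := QuotientAddGroup.mk_surjective a
  obtain ⟨Γ, hΓ, -⟩ := (AddCircle.isCoveringMap_coe (1 : ℝ)).exists_path_lifts α e
    (α.source.trans he.symm)
  exact ⟨Γ, fun t => congrFun hΓ t⟩

/-- The total change of angle along a path in the circle. -/
noncomputable def wind (α : Path a b) : ℝ :=
  (exists_path_lift α).choose 1 - (exists_path_lift α).choose 0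

lemma sub_eq_sub_of_lift {Γ Γ' : C(I, ℝ)}
    (h : ∀ t, (Γ t : AddCircle (1 : ℝ)) = (Γ' t : AddCircle (1 : ℝ))) (s t : I) :
    Γ s - Γ' s = Γ t - Γ' t := by
  refine congrFun (eq_of_torusProj_eq_zero (n := 1) (m := fun t _ => Γ t - Γ' t) (by fun_prop)
    (fun t => funext fun _ => ?_) s t) 0
  exact (AddCircle.coe_sub (1 : ℝ) _ _).trans (sub_eq_zero.2 (h t))

lemma wind_eq {α : Path a b} {Γ : C(I, ℝ)} (h : ∀ t, (Γ t : AddCircle (1 : ℝ)) = α t) :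
    wind α = Γ 1 - Γ 0 := by
  have := sub_eq_sub_of_lift (fun t => ((exists_path_lift α).choose_spec t).trans (h t).symm) 1 0
  rw [wind]
  linarith

lemma wind_homotopic {α β : Path a b} (h : α.Homotopic β) : wind α = wind β := by
  have cov := AddCircle.isCoveringMap_coe (1 : ℝ)
  obtain ⟨e, he⟩ := QuotientAddGroup.mk_surjective a
  have hα := α.source.trans he.symm
  have hβ := β.source.trans he.symm
  rw [wind_eq (Γ := cov.liftPath α e hα) (congrFun (cov.liftPath_lifts _ _ _)),
    wind_eq (Γ := cov.liftPath β e hβ) (congrFun (cov.liftPath_lifts _ _ _)),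
    cov.liftPath_zero, cov.liftPath_zero]
  exact congrArg (· - e) (cov.liftPath_apply_one_eq_of_homotopicRel h e hα hβ)

lemma wind_symm (α : Path a b) : wind α.symm = -wind α := by
  obtain ⟨Γ, hΓ⟩ := exists_path_lift α
  rw [wind_eq hΓ, wind_eq (α := α.symm) (Γ := Γ.comp ⟨σ, continuous_symm⟩) fun t => hΓ (σ t)]
  simp

lemma wind_trans (α : Path a b) (β : Path b c) : wind (α.trans β) = wind α + wind β := by
  obtain ⟨Γ, hΓ⟩ := exists_path_lift α
  obtain ⟨Δ, hΔ⟩ := exists_path_lift β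
  have h0 : ((Γ 1 - Δ 0 : ℝ) : AddCircle (1 : ℝ)) = 0 := by
    rw [AddCircle.coe_sub, hΓ, hΔ, α.target, β.source, sub_self]
  let p : Path (Γ 0) (Γ 1) := ⟨Γ, rfl, rfl⟩
  let q : Path (Γ 1) (Δ 1 + (Γ 1 - Δ 0)) :=
    ⟨⟨fun t => Δ t + (Γ 1 - Δ 0), by fun_prop⟩, by simp, rfl⟩
  rw [wind_eq hΓ, wind_eq hΔ, wind_eq (Γ := (p.trans q).toContinuousMap) fun t => ?_]
  · change (p.trans q) 1 - (p.trans q) 0 = _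
    rw [Path.target, Path.source]
    ring
  · change (((p.trans q) t : ℝ) : AddCircle (1 : ℝ)) = _
    rw [Path.trans_apply, Path.trans_apply]
    split_ifs
    · exact hΓ _
    · exact (AddCircle.coe_add (1 : ℝ) _ _).trans (by rw [h0, add_zero]; exact hΔ _)

end Winding

variable {N : Type*} [TopologicalSpace N]

lemma wind_map_add {x y : N} (γ : Path x y) (u v : C(N, AddCircle (1 : ℝ))) :
    wind (γ.map (u + v).continuous) = wind (γ.map u.continuous) + wind (γ.map v.continuous) := by
  obtain ⟨Γ, hΓ⟩ := exists_path_lift (γ.map u.continuous)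
  obtain ⟨Δ, hΔ⟩ := exists_path_lift (γ.map v.continuous)
  rw [wind_eq hΓ, wind_eq hΔ, wind_eq (Γ := Γ + Δ) fun t => ?_]
  · simp
    ring
  · exact (AddCircle.coe_add (1 : ℝ) _ _).trans (by rw [hΓ, hΔ]; rfl)

lemma exists_lift_of_wind_eq_zero [PathConnectedSpace N] [LocallyPathConnectedSpace N]
    (k : C(N, AddCircle (1 : ℝ))) (hk : ∀ x (γ : Path x x), wind (γ.map k.continuous) = 0) :
    ∃ h : C(N, ℝ), ∀ x, (h x : AddCircle (1 : ℝ)) = k x := by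
  have cov := AddCircle.isCoveringMap_coe (1 : ℝ)
  obtain ⟨x₀⟩ : Nonempty N := inferInstance
  obtain ⟨e, he⟩ := QuotientAddGroup.mk_surjective (k x₀)
  obtain ⟨h, ⟨-, hh⟩, -⟩ := cov.isLocalHomeomorph.existsUnique_continuousMap_lifts k x₀ e he
    (fun γ hγ => by
      obtain ⟨Γ, hΓ, hΓ0⟩ := cov.exists_path_lifts (k.comp γ) e (by simp [hγ, he])
      exact ⟨Γ, hΓ0, hΓ⟩)
    fun γ γ' Γ Γ' h0 h0' hΓ hΓ' hl hl' h1 => by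
      let p : Path x₀ (γ 1) := ⟨γ, h0, rfl⟩
      let p' : Path x₀ (γ 1) := ⟨γ', h0', h1.symm⟩
      have h2 := hk x₀ (p.trans p'.symm)
      rw [Path.map_trans, ← Path.map_symm, wind_trans, wind_symm,
        wind_eq (α := p.map k.continuous) (Γ := Γ) fun t => congrFun hl t,
        wind_eq (α := p'.map k.continuous) (Γ := Γ') fun t => congrFun hl' t, hΓ, hΓ'] at h2
      linarith
  exact ⟨h, congrFun hh⟩

lemma HasCharts.locallyPathConnectedSpace {n : ℕ} (hN : HasCharts n N) :
    LocallyPathConnectedSpace N := by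
  refine .of_bases (p := fun x V => IsChart n V ∧ x ∈ V) (s := fun _ V => V) (fun x =>
    ⟨fun U => ⟨fun hU => ?_, fun ⟨V, hV, hVU⟩ =>
      Filter.mem_of_superset (hV.1.isOpen.mem_nhds hV.2) hVU⟩⟩) fun x V hV => ?_
  · obtain ⟨V, hV, hx, hVU⟩ := hN x U hU
    exact ⟨V, ⟨hV, hx⟩, hVU⟩
  · obtain ⟨⟨j, hj, rfl⟩, -⟩ := hV
    exact isPathConnected_range hj.continuous

instance pathConnectedSpace_torus (n : ℕ) : PathConnectedSpace (Fin n → AddCircle (1 : ℝ)) :=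
  (torusProj_surjective n).pathConnectedSpace (continuous_torusProj n)

lemma pathConnectedSpace_of_homotopic {Y : Type*} [TopologicalSpace Y] [PathConnectedSpace Y]
    (f : C(N, Y)) (g : C(Y, N)) (h : (g.comp f).Homotopic (ContinuousMap.id N)) :
    PathConnectedSpace N := by
  obtain ⟨H⟩ := h
  have hx : ∀ x, Joined (g (f x)) x := fun x => ⟨H.evalAt x⟩
  exact ⟨(inferInstance : Nonempty Y).map g, fun x y => (hx x).symm.trans
    (.trans ⟨(PathConnectedSpace.somePath (f x) (f y)).map g.continuous⟩ (hx y))⟩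

lemma homotopic_sub_torusProj {n : ℕ} (f : C(N, Fin n → AddCircle (1 : ℝ))) (w : C(N, Fin n → ℝ)) :
    f.Homotopic (f - ContinuousMap.comp ⟨torusProj n, continuous_torusProj n⟩ w) := by
  have := continuous_torusProj n
  refine ⟨⟨⟨fun p => f p.2 - torusProj n ((p.1 : ℝ) • w p.2), by fun_prop⟩, fun x => ?_,
    fun x => ?_⟩⟩
  · simp [torusProj_zero]
  · simp

end AlexanderSpanier

namespace AlexanderSpanier

open Set Topology

lemma add_self_eq_zero_iff_circle {y : AddCircle (1 : ℝ)} :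
    y + y = 0 ↔ y = 0 ∨ y = ((1 / 2 : ℝ) : AddCircle (1 : ℝ)) := by
  constructor
  · obtain ⟨r, rfl⟩ := QuotientAddGroup.mk_surjective y
    intro h
    obtain ⟨k, hk⟩ :=
      (AddCircle.coe_eq_zero_iff (1 : ℝ)).1 ((AddCircle.coe_add (1 : ℝ) r r).trans h)
    have hk : (k : ℝ) = r + r := by simpa using hk
    obtain ⟨j, rfl | rfl⟩ := k.even_or_odd'
    · refine .inl ((AddCircle.coe_eq_zero_iff (1 : ℝ)).2 ⟨j, ?_⟩)
      push_cast at hk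
      simp only [zsmul_eq_mul, mul_one]
      linarith
    · refine .inr (sub_eq_zero.1 (((AddCircle.coe_sub (1 : ℝ) r (1 / 2)).symm).trans
        ((AddCircle.coe_eq_zero_iff (1 : ℝ)).2 ⟨j, ?_⟩)))
      push_cast at hk
      simp only [zsmul_eq_mul, mul_one]
      linarith
  · rintro (rfl | rfl)
    · exact add_zero 0
    · rw [← AddCircle.coe_add]
      norm_num

lemma half_ne_zero_circle : ((1 / 2 : ℝ) : AddCircle (1 : ℝ)) ≠ 0 := fun h => by
  obtain ⟨k, hk⟩ := (AddCircle.coe_eq_zero_iff (1 : ℝ)).1 h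
  have h2 : ((2 * k : ℤ) : ℝ) = (1 : ℤ) := by
    push_cast
    simp only [zsmul_eq_mul, mul_one] at hk
    linarith
  have := Int.cast_injective h2
  omega

lemma natCard_twoTorsion (n : ℕ) :
    Nat.card {t : Fin n → AddCircle (1 : ℝ) // t + t = 0} = 2 ^ n := by
  classical
  have h : Function.Bijective fun b : Fin n → Bool =>
      (⟨fun i => if b i then ((1 / 2 : ℝ) : AddCircle (1 : ℝ)) else 0, funext fun i =>
        add_self_eq_zero_iff_circle.2 (by by_cases h : b i <;> simp [h])⟩ :
        {t : Fin n → AddCircle (1 : ℝ) // t + t = 0}) := by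
    refine ⟨fun b b' h => funext fun i => ?_, fun ⟨t, ht⟩ => ?_⟩
    · have h1 := congrFun (congrArg Subtype.val h) i
      have := half_ne_zero_circle
      by_contra h2
      rcases Bool.eq_false_or_eq_true (b i) with h3 | h3 <;>
        rcases Bool.eq_false_or_eq_true (b' i) with h4 | h4 <;>
        simp only [h3, h4, if_true, if_false, Bool.false_eq_true, not_true] at h1 h2
      · exact this h1
      · exact this h1.symm
    · refine ⟨fun i => decide (t i = ((1 / 2 : ℝ) : AddCircle (1 : ℝ))),
        Subtype.ext (funext fun i => ?_)⟩
      rcases add_self_eq_zero_iff_circle.1 (congrFun ht i) with h | h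
      · have h0 : t i ≠ ((1 / 2 : ℝ) : AddCircle (1 : ℝ)) := by
          rw [h]
          exact half_ne_zero_circle.symm
        simp only [decide_eq_true_eq, if_neg h0]
        exact h.symm
      · simp only [decide_eq_true_eq, if_pos h]
        exact h.symm
  rw [← Nat.card_congr (Equiv.ofBijective _ h)]
  simp

/-- An involution acting by `-1` on the fundamental group is covered by an odd map to the torus,
up to a homotopy. -/
lemma exists_lift_add_comp {N : Type} [TopologicalSpace N] [PathConnectedSpace N]
    [LocallyPathConnectedSpace N] {n : ℕ} (f : C(N, Fin n → AddCircle (1 : ℝ))) {σ : N → N}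
    (hσ : Continuous σ) (hneg : H1Negative σ hσ) :
    ∃ h : C(N, Fin n → ℝ), ∀ x, torusProj n (h x) = f x + f (σ x) := by
  let u : Fin n → C(N, AddCircle (1 : ℝ)) := fun i => ⟨fun x => f x i, by fun_prop⟩
  have key : ∀ i, ∃ h : C(N, ℝ), ∀ x,
      (h x : AddCircle (1 : ℝ)) = (u i + (u i).comp ⟨σ, hσ⟩) x := fun i => by
    refine exists_lift_of_wind_eq_zero _ fun x γ => ?_
    let q := PathConnectedSpace.somePath (σ x) x
    have h1 := wind_homotopic ((hneg x γ q).map (u i))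
    rw [Path.map_trans, Path.map_trans, ← Path.map_symm, ← Path.map_symm, wind_trans, wind_trans,
      wind_symm, wind_symm] at h1
    have h2 : wind ((γ.map hσ).map (u i).continuous) =
      wind (γ.map ((u i).comp ⟨σ, hσ⟩).continuous) := rfl
    rw [wind_map_add]
    linarith
  choose h hh using key
  exact ⟨⟨fun x i => h i x, by fun_prop⟩, fun x => funext fun i => hh i x⟩

lemma comp_involutive_of_lift {N : Type*} [TopologicalSpace N] [PreconnectedSpace N] {n : ℕ}
    {f : N → Fin n → AddCircle (1 : ℝ)} {σ : N → N} (hσ : Continuous σ)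
    (hσσ : Function.Involutive σ) (h : C(N, Fin n → ℝ))
    (hh : ∀ x, torusProj n (h x) = f x + f (σ x)) (x : N) : h (σ x) = h x := by
  have h1 := eq_of_torusProj_eq_zero (m := fun x => h (σ x) - h x) (by fun_prop)
    (fun x => by rw [torusProj_sub, hh, hh, hσσ]; abel) x (σ x)
  simp only [hσσ x] at h1
  rw [← neg_sub (h (σ x)) (h x), self_eq_neg] at h1
  exact sub_eq_zero.1 h1

end AlexanderSpanier

open AlexanderSpanier in
/-- An `H₁`-negative involution of a compact topological `n`-manifold homotopy
equivalent to the `n`-torus has exactly `2ⁿ` fixed points. -/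
theorem involution_fixed_points_card (n : ℕ)
    (N : Type) [TopologicalSpace N] [T2Space N] [SecondCountableTopology N]
    [CompactSpace N] (hman : LocallyEuclidean n N)
    (hhe : Nonempty (ContinuousMap.HomotopyEquiv N (Torus n)))
    (σ : N → N) (hσ : Continuous σ) (hinvol : σ ∘ σ = id)
    (hneg : H1Negative σ hσ) :
    {x : N | σ x = x}.Finite ∧ {x : N | σ x = x}.ncard = 2 ^ n := by
  obtain ⟨e⟩ := hhe
  have hN := hman.hasCharts
  have hσσ : Function.Involutive σ := congrFun hinvol
  let _ : MetricSpace N := TopologicalSpace.metrizableSpaceMetric N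
  have := pathConnectedSpace_of_homotopic e.toFun e.invFun e.left_inv
  have := hN.locallyPathConnectedSpace
  obtain ⟨h, hh⟩ := exists_lift_add_comp e.toFun hσ hneg
  have hhσ := comp_involutive_of_lift hσ hσσ h hh
  let φ : N → Torus n := fun x => e.toFun x - torusProj n ((1 / 2 : ℝ) • h x)
  have hφ : ∀ x, φ x + φ (σ x) = 0 := fun x => by
    have h1 : (1 / 2 : ℝ) • h x + (1 / 2 : ℝ) • h x = h x := by
      rw [← add_smul]
      norm_num
    have h2 : φ x + φ (σ x) = (e.toFun x + e.toFun (σ x)) -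
        (torusProj n ((1 / 2 : ℝ) • h x) + torusProj n ((1 / 2 : ℝ) • h x)) := by
      simp only [φ, hhσ]
      abel
    rw [h2, ← torusProj_add, h1, hh, sub_self]
  have key : ∀ t : Torus n, t + t = 0 → ∃! x, σ x = x ∧ φ x - t = 0 := fun t ht => by
    obtain ⟨w, rfl⟩ := torusProj_surjective n t
    let F : C(N, Torus n) := e.toFun - ContinuousMap.comp ⟨torusProj n, continuous_torusProj n⟩
      ⟨fun x => (1 / 2 : ℝ) • h x + w, by fun_prop⟩
    have hF : ∀ x, F x = φ x - torusProj n w := fun x => by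
      change e.toFun x - torusProj n ((1 / 2 : ℝ) • h x + w) = _
      rw [torusProj_add, sub_add_eq_sub_sub]
    have hom : e.toFun.Homotopic F := homotopic_sub_torusProj _ _
    obtain ⟨Φ⟩ := nonempty_liftedEquiv F e.invFun
      ((hom.symm.comp (.refl e.invFun)).trans e.right_inv)
      (((ContinuousMap.Homotopic.refl e.invFun).comp hom.symm).trans e.left_inv)
    have := existsUnique_fixed_zero hN Φ hσ hσσ fun x => by
      rw [hF, hF, eq_neg_iff_add_eq_zero]
      have h3 : φ (σ x) - torusProj n w + (φ x - torusProj n w) =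
          (φ x + φ (σ x)) - (torusProj n w + torusProj n w) := by abel
      rw [h3, hφ, ht, sub_zero]
    simpa only [hF] using this
  let r : {x : N | σ x = x} → {t : Torus n // t + t = 0} := fun x =>
    ⟨φ x, by simpa only [show σ x = x from x.2] using hφ x⟩
  have hr : Function.Bijective r := by
    refine ⟨fun x y hxy => ?_, fun ⟨t, ht⟩ => ?_⟩
    · have h1 : φ x = φ y := congrArg Subtype.val hxy
      exact Subtype.ext ((key _ (r y).2).unique ⟨x.2, sub_eq_zero.2 h1⟩ ⟨y.2, sub_self _⟩)
    · obtain ⟨x, ⟨hx, hxt⟩, -⟩ := key t ht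
      exact ⟨⟨x, hx⟩, Subtype.ext (sub_eq_zero.1 hxt)⟩
  have hcard : {x : N | σ x = x}.ncard = 2 ^ n := by
    rw [← Nat.card_coe_set_eq, Nat.card_congr (Equiv.ofBijective r hr)]
    exact natCard_twoTorsion n
  exact ⟨Set.finite_of_ncard_ne_zero (by rw [hcard]; positivity), hcard⟩
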